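/- Suppose λ₀ ∈ ℝ satisfies |F(λ₀)| > 2. Let ε_k → 0, and for each k let (λ_k, u_k) be an eigenpair of the defect problem at parameter ε_k with ∫_ℝ |u_k|² = 1, and suppose λ_k → λ₀. Then there exist a constant C > 0 and, for each k, continuous functions v_k, w_k : ℝ → ℂ with u_k = v_k + w_k, such that: (i) v_k and w_k are differentiable at every point of ℝ ∖ S_{ε_k}, and v_k′ = 0 at every point of Ω₁^{ε_k} ∖ (D ∪ S_{ε_k}); (ii) ∫_ℝ |w_k|² ≤ C·ε_k⁴ and ∫_{ℝ∖S_{ε_k}} |w_k′|² ≤ C·ε_k²; (iii) for every α ∈ (0,1), ∫_{{x ∈ ℝ : dist(x,D) ≥ ε_k^α}} |v_k|² → 0 as k → ∞, where dist(x,D) := max{d₋ − x, x − d₊, 0}. -/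

import Mathlib

open Set MeasureTheory Filter Topology

open Set MeasureTheory Filter Topology

/-- The soft component `Ω₀^ε = ∪_z (εz, εz + εh)`. -/
def softComponent (h ε : ℝ) : Set ℝ :=
  {x | ∃ z : ℤ, ε * z < x ∧ x < ε * z + ε * h}

/-- The stiff component `Ω₁^ε = ∪_z (εz + εh, ε(z+1))`. -/
def stiffComponent (h ε : ℝ) : Set ℝ :=
  {x | ∃ z : ℤ, ε * z + ε * h < x ∧ x < ε * (z + 1)}

/-- The interface set `S_ε = {d₋, d₊} ∪ {εz} ∪ {ε(z+h)}`. -/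
def interfaceSet (h dm dp ε : ℝ) : Set ℝ :=
  {dm, dp} ∪ {x | ∃ z : ℤ, x = ε * z} ∪ {x | ∃ z : ℤ, x = ε * (z + h)}

open Classical in
/-- The coefficient `a_D^ε`: `a_D` on `D`, `ε² a₀(·/ε)` on `Ω₀^ε ∖ D`, `a₁(·/ε)` on
`Ω₁^ε ∖ D` (the remaining null set of interface points carries the value `a₁(·/ε)`). -/
noncomputable def defectCoef (h dm dp : ℝ) (a₀ a₁ aD : ℝ → ℝ) (ε x : ℝ) : ℝ :=
  if x ∈ Ioo dm dp then aD x
  else if x ∈ softComponent h ε then ε ^ 2 * a₀ (x / ε)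
  else a₁ (x / ε)

open Classical in
/-- The density `ρ_D^ε`: `ρ_D` on `D`, `ρ₀(·/ε)` on `Ω₀^ε ∖ D`, `ρ₁(·/ε)` on `Ω₁^ε ∖ D`. -/
noncomputable def defectDens (h dm dp : ℝ) (ρ₀ ρ₁ ρD : ℝ → ℝ) (ε x : ℝ) : ℝ :=
  if x ∈ Ioo dm dp then ρD x
  else if x ∈ softComponent h ε then ρ₀ (x / ε)
  else ρ₁ (x / ε)

/-- An eigenpair `(λ, u)` of the defect problem at parameter `ε`: `u` is nonzero, continuous
and square-integrable, and there is a continuous co-derivative `σ` with `σ = a_D^ε u′` and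
`σ′ = −λ ρ_D^ε u` away from the interface set. -/
def IsDefectEigenpair (h dm dp : ℝ) (a₀ ρ₀ a₁ ρ₁ aD ρD : ℝ → ℝ)
    (ε lam : ℝ) (u : ℝ → ℂ) : Prop :=
  (∃ x, u x ≠ 0) ∧ Continuous u ∧ Integrable (fun x => ‖u x‖ ^ 2) ∧
  ∃ σ : ℝ → ℂ, Continuous σ ∧
    ∀ x ∉ interfaceSet h dm dp ε,
      HasDerivAt u (σ x / (defectCoef h dm dp a₀ a₁ aD ε x : ℂ)) x ∧
      HasDerivAt σ (-((lam : ℂ) * (defectDens h dm dp ρ₀ ρ₁ ρD ε x : ℂ) * u x)) x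

/-- `dist(x, D)` for `D = (d₋, d₊)`. -/
def distDefect (dm dp x : ℝ) : ℝ := max (max (dm - x) (x - dp)) 0

/-- `(U, s)` solves `U' = b s`, `s' = -c U` on the open interval `(p, q)`. -/
structure IsSystemSolution (b c : ℝ → ℝ) (U s : ℝ → ℂ) (p q : ℝ) : Prop where
  cont_fst : Continuous U
  cont_snd : Continuous s
  deriv_fst : ∀ t ∈ Ioo p q, HasDerivAt U ((b t : ℂ) * s t) t
  deriv_snd : ∀ t ∈ Ioo p q, HasDerivAt s (-((c t : ℂ) * U t)) t

namespace IsSystemSolution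

variable {b c : ℝ → ℝ} {U s : ℝ → ℂ} {p q : ℝ}

lemma integral_fst (hs : IsSystemSolution b c U s p q) (hb : Continuous b) {x y : ℝ}
    (hx : p ≤ x) (hxy : x ≤ y) (hy : y ≤ q) :
    ∫ t in x..y, (b t : ℂ) * s t = U y - U x := by
  apply intervalIntegral.integral_eq_sub_of_hasDerivAt_of_le hxy hs.cont_fst.continuousOn
  · exact fun t ht => hs.deriv_fst t ⟨hx.trans_lt ht.1, ht.2.trans_le hy⟩
  · have := hs.cont_snd
    exact Continuous.intervalIntegrable (by fun_prop) _ _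

lemma integral_snd (hs : IsSystemSolution b c U s p q) (hc : Continuous c) {x y : ℝ}
    (hx : p ≤ x) (hxy : x ≤ y) (hy : y ≤ q) :
    ∫ t in x..y, -((c t : ℂ) * U t) = s y - s x := by
  apply intervalIntegral.integral_eq_sub_of_hasDerivAt_of_le hxy hs.cont_snd.continuousOn
  · exact fun t ht => hs.deriv_snd t ⟨hx.trans_lt ht.1, ht.2.trans_le hy⟩
  · have := hs.cont_fst
    exact Continuous.intervalIntegrable (by fun_prop) _ _

/-- Increments of the first component are controlled by the second one. -/
lemma norm_sub_fst_le (hs : IsSystemSolution b c U s p q) (hb : Continuous b) {B S : ℝ}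
    (hB0 : 0 ≤ B) (hB : ∀ t, |b t| ≤ B) (hS : ∀ t ∈ Icc p q, ‖s t‖ ≤ S) {x y : ℝ}
    (hx : p ≤ x) (hxy : x ≤ y) (hy : y ≤ q) :
    ‖U y - U x‖ ≤ B * S * (y - x) := by
  rw [← hs.integral_fst hb hx hxy hy, ← abs_of_nonneg (sub_nonneg.2 hxy)]
  apply intervalIntegral.norm_integral_le_of_norm_le_const
  intro t ht
  rw [uIoc_of_le hxy] at ht
  rw [norm_mul, Complex.norm_real, Real.norm_eq_abs]
  exact mul_le_mul (hB t) (hS t ⟨hx.trans ht.1.le, ht.2.trans hy⟩) (norm_nonneg _) hB0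

lemma abs_deriv_energy_le {β γ B : ℝ} (z w : ℂ) (hβ : |β| ≤ B) (hγ : |γ| ≤ B) :
    |2 * inner ℝ z ((β : ℂ) * w) + 2 * inner ℝ w (-((γ : ℂ) * z))|
      ≤ 2 * B * (‖z‖ ^ 2 + ‖w‖ ^ 2) := by
  have h1 : |inner ℝ z ((β : ℂ) * w)| ≤ B * (‖z‖ * ‖w‖) := by
    refine (abs_real_inner_le_norm _ _).trans ?_
    rw [norm_mul, Complex.norm_real, Real.norm_eq_abs]
    have := mul_le_mul_of_nonneg_right hβ (mul_nonneg (norm_nonneg z) (norm_nonneg w))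
    linarith
  have h2 : |inner ℝ w (-((γ : ℂ) * z))| ≤ B * (‖z‖ * ‖w‖) := by
    refine (abs_real_inner_le_norm _ _).trans ?_
    rw [norm_neg, norm_mul, Complex.norm_real, Real.norm_eq_abs]
    have := mul_le_mul_of_nonneg_right hγ (mul_nonneg (norm_nonneg z) (norm_nonneg w))
    linarith
  have hB : 0 ≤ B := (abs_nonneg _).trans hβ
  have h3 : B * (2 * (‖z‖ * ‖w‖)) ≤ B * (‖z‖ ^ 2 + ‖w‖ ^ 2) :=
    mul_le_mul_of_nonneg_left (by nlinarith [sq_nonneg (‖z‖ - ‖w‖)]) hB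
  rw [abs_le] at *
  constructor <;> linarith [h1.1, h1.2, h2.1, h2.2]

/-- The energy at two points of the interval is comparable. -/
lemma energy_le (hs : IsSystemSolution b c U s p q) {B : ℝ}
    (hb : ∀ t, |b t| ≤ B) (hc : ∀ t, |c t| ≤ B) (hpq : q - p ≤ 1)
    {x y : ℝ} (hx : x ∈ Icc p q) (hy : y ∈ Icc p q) :
    ‖U y‖ ^ 2 + ‖s y‖ ^ 2 ≤ Real.exp (2 * B) * (‖U x‖ ^ 2 + ‖s x‖ ^ 2) := by
  have hB : 0 ≤ B := (abs_nonneg _).trans (hb 0)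
  set N : ℝ → ℝ := fun t => ‖U t‖ ^ 2 + ‖s t‖ ^ 2 with hN
  have hNc : Continuous N := by
    have := hs.cont_fst
    have := hs.cont_snd
    fun_prop
  have hN0 : ∀ t, 0 ≤ N t := fun t => by positivity
  have hNd : ∀ t ∈ Ioo p q, ∃ N', HasDerivAt N N' t ∧ |N'| ≤ 2 * B * N t := fun t ht =>
    ⟨_, (hs.deriv_fst t ht).norm_sq.add (hs.deriv_snd t ht).norm_sq,
      abs_deriv_energy_le _ _ (hb t) (hc t)⟩
  have key : ∀ σ : ℝ, |σ| = 2 * B → ∀ t ∈ Ioo p q,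
      ∃ d, HasDerivAt (fun t => Real.exp (σ * t) * N t) (Real.exp (σ * t) * d) t ∧
        (σ = 2 * B → 0 ≤ d) ∧ (σ = -(2 * B) → d ≤ 0) := by
    intro σ _ t ht
    obtain ⟨N', h1, h2⟩ := hNd t ht
    refine ⟨σ * N t + N', ?_, ?_, ?_⟩
    · have h3 : HasDerivAt (fun t => Real.exp (σ * t)) (Real.exp (σ * t) * (σ * 1)) t :=
        ((hasDerivAt_id t).const_mul σ).exp
      refine (h3.mul h1).congr_deriv ?_
      ring
    · rintro rfl
      linarith [(abs_le.1 h2).1]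
    · rintro rfl
      linarith [(abs_le.1 h2).2]
  have habs : |2 * B| = 2 * B := abs_of_nonneg (by linarith)
  have hcc : ∀ σ : ℝ, Continuous (fun t => Real.exp (σ * t) * N t) := fun σ => by fun_prop
  have hmono : MonotoneOn (fun t => Real.exp (2 * B * t) * N t) (Icc p q) := by
    apply monotoneOn_of_deriv_nonneg (convex_Icc p q) (hcc _).continuousOn
    · intro t ht
      rw [interior_Icc] at ht
      obtain ⟨d, h1, -⟩ := key _ habs t ht
      exact h1.differentiableAt.differentiableWithinAt
    · intro t ht
      rw [interior_Icc] at ht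
      obtain ⟨d, h1, h2, -⟩ := key _ habs t ht
      rw [h1.deriv]
      exact mul_nonneg (Real.exp_pos _).le (h2 rfl)
  have hanti : AntitoneOn (fun t => Real.exp (-(2 * B) * t) * N t) (Icc p q) := by
    apply antitoneOn_of_deriv_nonpos (convex_Icc p q) (hcc _).continuousOn
    · intro t ht
      rw [interior_Icc] at ht
      obtain ⟨d, h1, -⟩ := key (-(2 * B)) (by rw [abs_neg, habs]) t ht
      exact h1.differentiableAt.differentiableWithinAt
    · intro t ht
      rw [interior_Icc] at ht
      obtain ⟨d, h1, -, h2⟩ := key (-(2 * B)) (by rw [abs_neg, habs]) t ht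
      rw [h1.deriv]
      exact mul_nonpos_of_nonneg_of_nonpos (Real.exp_pos _).le (h2 rfl)
  change N y ≤ Real.exp (2 * B) * N x
  have hfin : ∀ a : ℝ, ∀ d : ℝ, Real.exp a * N y ≤ Real.exp d * N x → d - a ≤ 2 * B →
      N y ≤ Real.exp (2 * B) * N x := by
    intro a d had hle
    have : N y ≤ Real.exp (d - a) * N x := by
      rw [Real.exp_sub, div_mul_eq_mul_div, le_div_iff₀ (Real.exp_pos _)]
      linarith
    exact this.trans (mul_le_mul_of_nonneg_right (Real.exp_le_exp.2 hle) (hN0 x))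
  rcases le_total x y with hxy | hxy
  · refine hfin _ _ (hanti hx hy hxy) ?_
    nlinarith [hx.1, hy.2]
  · refine hfin _ _ (hmono hy hx hxy) ?_
    nlinarith [hx.2, hy.1]

end IsSystemSolution

lemma exists_norm_mul_le_integral {U : ℝ → ℂ} (hU : Continuous U) {p q : ℝ} (hpq : p ≤ q) :
    ∃ y ∈ Icc p q, ‖U y‖ * (q - p) ≤ ∫ t in p..q, ‖U t‖ := by
  obtain ⟨y, hy, hmin⟩ := isCompact_Icc.exists_isMinOn (nonempty_Icc.2 hpq)
    (hU.norm.continuousOn (s := Icc p q))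
  refine ⟨y, hy, ?_⟩
  have h1 : ∫ _ in p..q, ‖U y‖ ≤ ∫ t in p..q, ‖U t‖ :=
    intervalIntegral.integral_mono_on hpq (continuous_const.intervalIntegrable _ _)
      (hU.norm.intervalIntegrable _ _) fun t ht => hmin ht
  rw [intervalIntegral.integral_const, smul_eq_mul] at h1
  linarith

lemma integral_norm_le_of_subinterval {U : ℝ → ℂ} (hU : Continuous U) {p x y q : ℝ}
    (hx : p ≤ x) (hxy : x ≤ y) (hy : y ≤ q) :
    ∫ t in x..y, ‖U t‖ ≤ ∫ t in p..q, ‖U t‖ := by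
  apply intervalIntegral.integral_mono_interval hx hxy hy
  · exact Eventually.of_forall fun t => norm_nonneg _
  · exact hU.norm.intervalIntegrable _ _

lemma sq_integral_norm_le {U : ℝ → ℂ} (hU : Continuous U) {p q : ℝ} (hpq : p ≤ q)
    (hpq1 : q - p ≤ 1) :
    (∫ t in p..q, ‖U t‖) ^ 2 ≤ ∫ t in p..q, ‖U t‖ ^ 2 := by
  set L := ∫ t in p..q, ‖U t‖ with hL
  have h1 : 0 ≤ ∫ t in p..q, (‖U t‖ - L) ^ 2 :=
    intervalIntegral.integral_nonneg hpq fun t _ => sq_nonneg _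
  have h2 : ∫ t in p..q, (‖U t‖ - L) ^ 2
      = (∫ t in p..q, ‖U t‖ ^ 2) - 2 * L * L + L ^ 2 * (q - p) := by
    have : ∀ t, (‖U t‖ - L) ^ 2 = (‖U t‖ ^ 2 - 2 * L * ‖U t‖) + L ^ 2 := fun t => by ring
    simp_rw [this]
    rw [intervalIntegral.integral_add, intervalIntegral.integral_sub,
      intervalIntegral.integral_const_mul, intervalIntegral.integral_const, smul_eq_mul]
    · ring
    all_goals exact Continuous.intervalIntegrable (by fun_prop) _ _
  nlinarith [sq_nonneg L]

/-- Observability: on an interval of length `h` where `b` is bounded below, the energy is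
controlled by the mass of the first component. -/
lemma exists_energy_le_integral_sq {β B h : ℝ} (hβ : 0 < β) (hB : 0 ≤ B) (hh0 : 0 < h)
    (hh1 : h ≤ 1) :
    ∃ K > 0, ∀ (b c : ℝ → ℝ) (U s : ℝ → ℂ) (p : ℝ), Continuous b → Continuous c →
      (∀ t, β ≤ b t) → (∀ t, |b t| ≤ B) → (∀ t, |c t| ≤ B) →
      IsSystemSolution b c U s p (p + h) → ∀ y ∈ Icc p (p + h),
      ‖U y‖ ^ 2 + ‖s y‖ ^ 2 ≤ K * ∫ t in p..p + h, ‖U t‖ ^ 2 := by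
  set κ := 3 / (β * h) * (6 / h + B * B) with hκ
  refine ⟨Real.exp (2 * B) * ((3 / h) ^ 2 + κ ^ 2), by positivity, ?_⟩
  intro b c U s p hbc hcc hbβ hb hc hs y hy
  set L := ∫ t in p..p + h, ‖U t‖ with hL
  have hU := hs.cont_fst
  have hsc := hs.cont_snd
  obtain ⟨y₁, hy₁, hUy₁⟩ := exists_norm_mul_le_integral hU (show p ≤ p + h / 3 by linarith)
  obtain ⟨y₂, hy₂, hUy₂⟩ :=
    exists_norm_mul_le_integral hU (show p + 2 * h / 3 ≤ p + h by linarith)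
  have hL₁ := integral_norm_le_of_subinterval hU le_rfl
    (show p ≤ p + h / 3 by linarith) (show p + h / 3 ≤ p + h by linarith)
  have hL₂ := integral_norm_le_of_subinterval hU (show p ≤ p + 2 * h / 3 by linarith)
    (show p + 2 * h / 3 ≤ p + h by linarith) le_rfl
  have h1 : ‖U y₁‖ ≤ 3 / h * L := by
    rw [div_mul_eq_mul_div, le_div_iff₀ hh0]
    nlinarith
  have h2 : ‖U y₂‖ ≤ 3 / h * L := by
    rw [div_mul_eq_mul_div, le_div_iff₀ hh0]
    nlinarith
  have hy₁₂ : y₁ ≤ y₂ := by linarith [hy₁.2, hy₂.1]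
  have hL0 : 0 ≤ L := intervalIntegral.integral_nonneg (by linarith) fun t _ => norm_nonneg _
  have hsd : ∀ t ∈ Icc y₁ y₂, ‖s t - s y₁‖ ≤ B * L := by
    intro t ht
    rw [← hs.integral_snd hcc hy₁.1 ht.1 (ht.2.trans hy₂.2)]
    calc ‖∫ x in y₁..t, -((c x : ℂ) * U x)‖ ≤ ∫ x in y₁..t, B * ‖U x‖ := by
          apply intervalIntegral.norm_integral_le_of_norm_le ht.1
          · refine Eventually.of_forall fun x _ => ?_
            rw [norm_neg, norm_mul, Complex.norm_real, Real.norm_eq_abs]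
            exact mul_le_mul_of_nonneg_right (hc x) (norm_nonneg _)
          · exact Continuous.intervalIntegrable (by fun_prop) _ _
      _ = B * ∫ x in y₁..t, ‖U x‖ := intervalIntegral.integral_const_mul _ _
      _ ≤ B * L := mul_le_mul_of_nonneg_left
          (integral_norm_le_of_subinterval hU hy₁.1 ht.1 (ht.2.trans hy₂.2)) hB
  have h3 : ((∫ t in y₁..y₂, b t : ℝ) : ℂ) * s y₁
      = (U y₂ - U y₁) - ∫ t in y₁..y₂, (b t : ℂ) * (s t - s y₁) := by
    rw [← hs.integral_fst hbc hy₁.1 hy₁₂ hy₂.2]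
    simp_rw [mul_sub]
    rw [intervalIntegral.integral_sub, intervalIntegral.integral_mul_const,
      intervalIntegral.integral_ofReal]
    · ring
    all_goals exact Continuous.intervalIntegrable (by fun_prop) _ _
  have h4 : ‖∫ t in y₁..y₂, (b t : ℂ) * (s t - s y₁)‖ ≤ B * (B * L) * 1 := by
    have : ‖∫ t in y₁..y₂, (b t : ℂ) * (s t - s y₁)‖ ≤ B * (B * L) * |y₂ - y₁| := by
      apply intervalIntegral.norm_integral_le_of_norm_le_const
      intro t ht
      rw [uIoc_of_le hy₁₂] at ht
      rw [norm_mul, Complex.norm_real, Real.norm_eq_abs]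
      exact mul_le_mul (hb t) (hsd t ⟨ht.1.le, ht.2⟩) (norm_nonneg _) hB
    refine this.trans (mul_le_mul_of_nonneg_left ?_ (by positivity))
    rw [abs_of_nonneg (sub_nonneg.2 hy₁₂)]
    linarith [hy₁.1, hy₂.2]
  have h5 : β * (h / 3) ≤ ∫ t in y₁..y₂, b t := by
    have : ∫ _ in y₁..y₂, β ≤ ∫ t in y₁..y₂, b t :=
      intervalIntegral.integral_mono_on hy₁₂ (continuous_const.intervalIntegrable _ _)
        (hbc.intervalIntegrable _ _) fun t _ => hbβ t
    rw [intervalIntegral.integral_const, smul_eq_mul] at this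
    nlinarith [hy₁.2, hy₂.1]
  have h6 : β * (h / 3) * ‖s y₁‖ ≤ (6 / h + B * B) * L := by
    have h7 : β * (h / 3) * ‖s y₁‖ ≤ ‖((∫ t in y₁..y₂, b t : ℝ) : ℂ) * s y₁‖ := by
      rw [norm_mul, Complex.norm_real, Real.norm_eq_abs]
      exact mul_le_mul_of_nonneg_right (h5.trans (le_abs_self _)) (norm_nonneg _)
    rw [h3] at h7
    have h8 := norm_sub_le (U y₂ - U y₁) (∫ t in y₁..y₂, (b t : ℂ) * (s t - s y₁))
    have h9 := norm_sub_le (U y₂) (U y₁)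
    have h10 : (6 / h + B * B) * L = 3 / h * L + 3 / h * L + B * (B * L) * 1 := by ring
    linarith
  have h7 : ‖s y₁‖ ≤ κ * L := by
    have : κ * L = ((6 / h + B * B) * L) / (β * (h / 3)) := by
      rw [hκ]
      field_simp
    rw [this, le_div_iff₀ (by positivity)]
    linarith
  have h8 : ‖U y₁‖ ^ 2 + ‖s y₁‖ ^ 2 ≤ ((3 / h) ^ 2 + κ ^ 2) * L ^ 2 := by
    have e1 := pow_le_pow_left₀ (norm_nonneg _) h1 2
    have e2 := pow_le_pow_left₀ (norm_nonneg _) h7 2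
    nlinarith
  have h9 := hs.energy_le hb hc (by linarith) (x := y₁) (y := y)
    ⟨hy₁.1, by linarith [hy₁.2]⟩ hy
  refine h9.trans ?_
  rw [mul_assoc]
  refine mul_le_mul_of_nonneg_left (h8.trans ?_) (Real.exp_pos _).le
  exact mul_le_mul_of_nonneg_left
    (sq_integral_norm_le hU (by linarith) (by linarith)) (by positivity)

/-- Bounds on the coefficients of the rescaled problem; `η` is the smallness of the stiff
resistivity `b₁`. -/
structure CoefBounds (β M η : ℝ) (b₀ c₀ b₁ c₁ : ℝ → ℝ) : Prop where
  cont_b₀ : Continuous b₀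
  cont_c₀ : Continuous c₀
  cont_b₁ : Continuous b₁
  cont_c₁ : Continuous c₁
  le_b₀ : ∀ t, β ≤ b₀ t
  abs_b₀ : ∀ t, |b₀ t| ≤ M
  abs_c₀ : ∀ t, |c₀ t| ≤ M
  abs_b₁ : ∀ t, |b₁ t| ≤ M
  abs_c₁ : ∀ t, |c₁ t| ≤ M
  abs_b₁_le : ∀ t, |b₁ t| ≤ η * M

/-- The defect eigenvalue system in the variable `t = x / ε`, where the defect is `(A, B)`. -/
structure IsCellSolution (h A B : ℝ) (b₀ c₀ b₁ c₁ : ℝ → ℝ) (U s : ℝ → ℂ) : Prop where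
  cont_fst : Continuous U
  cont_snd : Continuous s
  soft : ∀ z : ℤ, ∀ t ∈ Ioo (z : ℝ) (z + h), t < A ∨ B < t →
    HasDerivAt U ((b₀ t : ℂ) * s t) t ∧ HasDerivAt s (-((c₀ t : ℂ) * U t)) t
  stiff : ∀ z : ℤ, ∀ t ∈ Ioo ((z : ℝ) + h) (z + 1), t < A ∨ B < t →
    HasDerivAt U ((b₁ t : ℂ) * s t) t ∧ HasDerivAt s (-((c₁ t : ℂ) * U t)) t

/-- The mass of `U` on the `z`-th cell. -/
noncomputable def cellMass (U : ℝ → ℂ) (z : ℤ) : ℝ := ∫ t in (z : ℝ)..z + 1, ‖U t‖ ^ 2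

/-- The `z`-th cell does not meet the defect `(A, B)`. -/
def OffDefect (A B : ℝ) (z : ℤ) : Prop := (z : ℝ) + 1 ≤ A ∨ B ≤ z

lemma cellMass_nonneg (U : ℝ → ℂ) (z : ℤ) : 0 ≤ cellMass U z :=
  intervalIntegral.integral_nonneg (by linarith) fun t _ => by positivity

namespace IsCellSolution

variable {h A B : ℝ} {b₀ c₀ b₁ c₁ : ℝ → ℝ} {U s : ℝ → ℂ}

lemma soft_system (hS : IsCellSolution h A B b₀ c₀ b₁ c₁ U s) {z : ℤ} {p q : ℝ}
    (hp : (z : ℝ) ≤ p) (hq : q ≤ z + h) (hoff : q ≤ A ∨ B ≤ p) :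
    IsSystemSolution b₀ c₀ U s p q := by
  have key : ∀ t ∈ Ioo p q, HasDerivAt U ((b₀ t : ℂ) * s t) t ∧
      HasDerivAt s (-((c₀ t : ℂ) * U t)) t := fun t ht =>
    hS.soft z t ⟨hp.trans_lt ht.1, ht.2.trans_le hq⟩
      (hoff.imp (fun h => ht.2.trans_le h) (fun h => h.trans_lt ht.1))
  exact ⟨hS.cont_fst, hS.cont_snd, fun t ht => (key t ht).1, fun t ht => (key t ht).2⟩

lemma stiff_system (hS : IsCellSolution h A B b₀ c₀ b₁ c₁ U s) {z : ℤ} {p q : ℝ}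
    (hp : (z : ℝ) + h ≤ p) (hq : q ≤ z + 1) (hoff : q ≤ A ∨ B ≤ p) :
    IsSystemSolution b₁ c₁ U s p q := by
  have key : ∀ t ∈ Ioo p q, HasDerivAt U ((b₁ t : ℂ) * s t) t ∧
      HasDerivAt s (-((c₁ t : ℂ) * U t)) t := fun t ht =>
    hS.stiff z t ⟨hp.trans_lt ht.1, ht.2.trans_le hq⟩
      (hoff.imp (fun h => ht.2.trans_le h) (fun h => h.trans_lt ht.1))
  exact ⟨hS.cont_fst, hS.cont_snd, fun t ht => (key t ht).1, fun t ht => (key t ht).2⟩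

/-- The energy at two points of a cell outside the defect is comparable. -/
lemma energy_cell_le (hS : IsCellSolution h A B b₀ c₀ b₁ c₁ U s) {β M η : ℝ}
    (hc : CoefBounds β M η b₀ c₀ b₁ c₁) (hh0 : 0 < h) (hh1 : h < 1) {z : ℤ}
    (hz : OffDefect A B z) {x y : ℝ} (hx : x ∈ Icc (z : ℝ) (z + 1))
    (hy : y ∈ Icc (z : ℝ) (z + 1)) :
    ‖U y‖ ^ 2 + ‖s y‖ ^ 2 ≤ Real.exp (2 * M) ^ 2 * (‖U x‖ ^ 2 + ‖s x‖ ^ 2) := by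
  have hM : 0 ≤ M := (abs_nonneg _).trans (hc.abs_b₀ 0)
  have h0 := hS.soft_system (z := z) (p := z) (q := z + h) le_rfl le_rfl
    (hz.imp (fun h => by linarith) id)
  have h1 := hS.stiff_system (z := z) (p := z + h) (q := z + 1) le_rfl le_rfl
    (hz.imp id (fun h => by linarith))
  have e0 := fun {x y : ℝ} hx hy => h0.energy_le hc.abs_b₀ hc.abs_c₀ (by linarith) (x := x)
    (y := y) hx hy
  have e1 := fun {x y : ℝ} hx hy => h1.energy_le hc.abs_b₁ hc.abs_c₁ (by linarith) (x := x)
    (y := y) hx hy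
  have hE : 1 ≤ Real.exp (2 * M) := Real.one_le_exp (by linarith)
  have hmid0 : (z : ℝ) + h ∈ Icc (z : ℝ) (z + h) := ⟨by linarith, le_rfl⟩
  have hmid1 : (z : ℝ) + h ∈ Icc ((z : ℝ) + h) (z + 1) := ⟨le_rfl, by linarith⟩
  have hstep : ∀ {n : ℝ}, 0 ≤ n → Real.exp (2 * M) * n ≤ Real.exp (2 * M) ^ 2 * n := by
    intro n hn
    exact mul_le_mul_of_nonneg_right (by nlinarith) hn
  have hcomb : ∀ {a b c : ℝ}, a ≤ Real.exp (2 * M) * b → b ≤ Real.exp (2 * M) * c →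
      a ≤ Real.exp (2 * M) ^ 2 * c := by
    intro a b c hab hbc
    nlinarith [mul_le_mul_of_nonneg_left hbc (Real.exp_pos (2 * M)).le]
  rcases le_total x (z + h) with hxh | hxh <;> rcases le_total y (z + h) with hyh | hyh
  · exact (e0 ⟨hx.1, hxh⟩ ⟨hy.1, hyh⟩).trans (hstep (by positivity))
  · exact hcomb (e1 hmid1 ⟨hyh, hy.2⟩) (e0 ⟨hx.1, hxh⟩ hmid0)
  · exact hcomb (e0 hmid0 ⟨hy.1, hyh⟩) (e1 ⟨hxh, hx.2⟩ hmid1)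
  · exact (e1 ⟨hxh, hx.2⟩ ⟨hyh, hy.2⟩).trans (hstep (by positivity))

lemma soft_integral_le_cellMass (hU : Continuous U) (hh0 : 0 < h) (hh1 : h < 1) (z : ℤ) :
    ∫ t in (z : ℝ)..z + h, ‖U t‖ ^ 2 ≤ cellMass U z := by
  apply intervalIntegral.integral_mono_interval le_rfl (by linarith) (by linarith)
  · exact Eventually.of_forall fun t => by positivity
  · exact (hU.norm.pow 2).intervalIntegrable _ _

end IsCellSolution

/-- Energy bounds outside the defect, in terms of the mass of neighbouring cells and with a
constant independent of the solution. -/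
lemma exists_energy_le_cellMass {β M h : ℝ} (hβ : 0 < β) (hM : 0 ≤ M) (hh0 : 0 < h)
    (hh1 : h < 1) :
    ∃ K > 0, ∀ (η A B : ℝ) (b₀ c₀ b₁ c₁ : ℝ → ℝ) (U s : ℝ → ℂ),
      CoefBounds β M η b₀ c₀ b₁ c₁ → IsCellSolution h A B b₀ c₀ b₁ c₁ U s → ∀ z : ℤ,
      (((z : ℝ) + h ≤ A ∨ B ≤ z) → ∀ t ∈ Icc (z : ℝ) (z + h),
        ‖U t‖ ^ 2 + ‖s t‖ ^ 2 ≤ K * cellMass U z) ∧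
      (∀ t ∈ Icc ((z : ℝ) + h) (z + 1), B ≤ t →
        ‖U t‖ ^ 2 + ‖s t‖ ^ 2 ≤ K * cellMass U (z + 1)) ∧
      (∀ t ∈ Icc ((z : ℝ) + h) (z + 1), t ≤ A →
        ‖U t‖ ^ 2 + ‖s t‖ ^ 2 ≤ K * cellMass U z) := by
  obtain ⟨K, hK, hobs⟩ := exists_energy_le_integral_sq hβ hM hh0 hh1.le
  have hE : 1 ≤ Real.exp (2 * M) := Real.one_le_exp (by linarith)
  refine ⟨Real.exp (2 * M) * K, by positivity, ?_⟩
  intro η A B b₀ c₀ b₁ c₁ U s hc hS z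
  have hsoft : ∀ z : ℤ, ((z : ℝ) + h ≤ A ∨ B ≤ z) → ∀ t ∈ Icc (z : ℝ) (z + h),
      ‖U t‖ ^ 2 + ‖s t‖ ^ 2 ≤ K * cellMass U z := fun z hz t ht =>
    (hobs b₀ c₀ U s z hc.cont_b₀ hc.cont_c₀ hc.le_b₀ hc.abs_b₀ hc.abs_c₀
      (hS.soft_system le_rfl le_rfl hz) t ht).trans
      (mul_le_mul_of_nonneg_left
        (IsCellSolution.soft_integral_le_cellMass hS.cont_fst hh0 hh1 z) hK.le)
  have hcomb : ∀ {a b c : ℝ}, a ≤ Real.exp (2 * M) * b → b ≤ K * c →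
      a ≤ Real.exp (2 * M) * K * c := by
    intro a b c hab hbc
    nlinarith [mul_le_mul_of_nonneg_left hbc (Real.exp_pos (2 * M)).le]
  refine ⟨fun hz t ht => ?_, fun t ht hBt => ?_, fun t ht hAt => ?_⟩
  · refine (hsoft z hz t ht).trans (mul_le_mul_of_nonneg_right ?_ (cellMass_nonneg _ _))
    nlinarith
  · have h1 := hS.stiff_system (z := z) (p := t) (q := z + 1) ht.1 le_rfl (Or.inr hBt)
    have h2 := h1.energy_le hc.abs_b₁ hc.abs_c₁ (by linarith [ht.1]) (x := z + 1) (y := t)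
      ⟨ht.2, le_rfl⟩ ⟨le_rfl, ht.2⟩
    have h3 := hsoft (z + 1) (Or.inr (by push_cast; linarith [ht.2])) (z + 1)
      ⟨by push_cast; rfl, by push_cast; linarith⟩
    exact hcomb h2 h3
  · have h1 := hS.stiff_system (z := z) (p := z + h) (q := t) le_rfl ht.2 (Or.inl hAt)
    have h2 := h1.energy_le hc.abs_b₁ hc.abs_c₁ (by linarith [ht.2]) (x := z + h) (y := t)
      ⟨le_rfl, ht.1⟩ ⟨ht.1, le_rfl⟩
    have h3 := hsoft z (Or.inl (ht.1.trans hAt)) (z + h) ⟨by linarith, le_rfl⟩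
    exact hcomb h2 h3

/-- A solution of a system tested against a reference solution `(v, w)` of a nearby system:
the Wronskian-type pairing is almost conserved. -/
lemma IsSystemSolution.norm_pairing_sub_le {b c c' : ℝ → ℝ} {U s : ℝ → ℂ} {z h : ℝ}
    (hs : IsSystemSolution b c U s z (z + h)) (hh0 : 0 < h) (hh1 : h ≤ 1)
    (hcc : Continuous c) (hcc' : Continuous c') {v w : ℝ → ℝ}
    (hv : ∀ y ∈ Icc (0:ℝ) h, HasDerivAt v (b y * w y) y)
    (hw : ∀ y ∈ Icc (0:ℝ) h, HasDerivAt w (-(c' y * v y)) y)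
    (hbz : ∀ y, b (y + z) = b y) (hcz : ∀ y, c' (y + z) = c' y) {δ R V : ℝ} (hδ0 : 0 ≤ δ)
    (hR : ∀ t ∈ Icc z (z + h), ‖U t‖ ≤ R) (hδ : ∀ t, |c t - c' t| ≤ δ)
    (hV : ∀ y ∈ Icc (0:ℝ) h, |v y| ≤ V) :
    ‖(U (z + h) * w h - s (z + h) * v h) - (U z * w 0 - s z * v 0)‖ ≤ δ * R * V := by
  have hU := hs.cont_fst
  have hsc := hs.cont_snd
  have hsub : MapsTo (fun t => t - z) (Icc z (z + h)) (Icc 0 h) := fun t ht =>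
    ⟨by linarith [ht.1], by linarith [ht.2]⟩
  have hvc : ContinuousOn (fun t => ((v (t - z) : ℝ) : ℂ)) (Icc z (z + h)) :=
    Complex.continuous_ofReal.comp_continuousOn
      (ContinuousOn.comp (t := Icc 0 h)
        (fun y hy => (hv y hy).continuousAt.continuousWithinAt)
        (by fun_prop) hsub)
  have hwc : ContinuousOn (fun t => ((w (t - z) : ℝ) : ℂ)) (Icc z (z + h)) :=
    Complex.continuous_ofReal.comp_continuousOn
      (ContinuousOn.comp (t := Icc 0 h)
        (fun y hy => (hw y hy).continuousAt.continuousWithinAt)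
        (by fun_prop) hsub)
  have hd : ∀ t ∈ Ioo z (z + h), HasDerivAt
      (fun t => U t * ((w (t - z) : ℝ) : ℂ) - s t * ((v (t - z) : ℝ) : ℂ))
      (((c t - c' t : ℝ) : ℂ) * U t * ((v (t - z) : ℝ) : ℂ)) t := by
    intro t ht
    have hm := hsub (Ioo_subset_Icc_self ht)
    have h1 := ((hv _ hm).comp_sub_const t z).ofReal_comp
    have h2 := ((hw _ hm).comp_sub_const t z).ofReal_comp
    have eb : b (t - z) = b t := by rw [← hbz (t - z), sub_add_cancel]
    have ec : c' (t - z) = c' t := by rw [← hcz (t - z), sub_add_cancel]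
    refine (((hs.deriv_fst t ht).mul h2).sub ((hs.deriv_snd t ht).mul h1)).congr_deriv ?_
    rw [eb, ec]
    push_cast
    ring
  have hInt := intervalIntegral.integral_eq_sub_of_hasDerivAt_of_le
    (f := fun t => U t * ((w (t - z) : ℝ) : ℂ) - s t * ((v (t - z) : ℝ) : ℂ))
    (show z ≤ z + h by linarith) ((hU.continuousOn.mul hwc).sub (hsc.continuousOn.mul hvc)) hd
    (ContinuousOn.intervalIntegrable (by
      rw [uIcc_of_le (by linarith)]
      exact ContinuousOn.mul (by fun_prop) hvc))
  simp only [add_sub_cancel_left, sub_self] at hInt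
  have hR0 : 0 ≤ R := (norm_nonneg _).trans (hR z ⟨le_rfl, by linarith⟩)
  have hV0 : 0 ≤ V := (abs_nonneg _).trans (hV 0 ⟨le_rfl, hh0.le⟩)
  rw [← hInt]
  refine (intervalIntegral.norm_integral_le_of_norm_le_const (C := δ * R * V) ?_).trans ?_
  · intro t ht
    rw [uIoc_of_le (by linarith)] at ht
    have hm : t ∈ Icc z (z + h) := ⟨ht.1.le, ht.2⟩
    rw [norm_mul, norm_mul, Complex.norm_real, Complex.norm_real, Real.norm_eq_abs,
      Real.norm_eq_abs]
    exact mul_le_mul (mul_le_mul (hδ t) (hR t hm) (norm_nonneg _) hδ0) (hV _ (hsub hm))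
      (abs_nonneg _) (by positivity)
  · rw [add_sub_cancel_left, abs_of_pos hh0]
    exact mul_le_of_le_one_right (by positivity) hh1

/-- On a stiff interval `U` is almost constant and `s` changes by `-(∫ c') U`. -/
lemma IsSystemSolution.norm_stiff_jump_le {b c c' : ℝ → ℝ} {U s : ℝ → ℂ} {p q : ℝ}
    (hs : IsSystemSolution b c U s p q) (hpq : p ≤ q) (hpq1 : q - p ≤ 1)
    (hbc : Continuous b) (hcc : Continuous c) (hcc' : Continuous c') {δ η M R : ℝ}
    (hη : 0 ≤ η) (hM : 0 ≤ M) (hb : ∀ t, |b t| ≤ η * M) (hc' : ∀ t, |c' t| ≤ M)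
    (hδ : ∀ t, |c t - c' t| ≤ δ)
    (hRU : ∀ t ∈ Icc p q, ‖U t‖ ≤ R) (hRs : ∀ t ∈ Icc p q, ‖s t‖ ≤ R) :
    ‖U q - U p‖ ≤ η * M * R ∧
    ‖s q - s p + ((∫ t in p..q, c' t : ℝ) : ℂ) * U p‖ ≤ (M * (η * M) + δ) * R := by
  have hU := hs.cont_fst
  have hR0 : 0 ≤ R := (norm_nonneg _).trans (hRU p ⟨le_rfl, hpq⟩)
  have hδ0 : 0 ≤ δ := (abs_nonneg _).trans (hδ p)
  have hlip : ∀ t ∈ Icc p q, ‖U t - U p‖ ≤ η * M * R := by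
    intro t ht
    refine (hs.norm_sub_fst_le hbc (by positivity) hb hRs le_rfl ht.1 ht.2).trans ?_
    exact mul_le_of_le_one_right (by positivity) (by linarith [ht.2])
  refine ⟨hlip q ⟨hpq, le_rfl⟩, ?_⟩
  have heq : s q - s p + ((∫ t in p..q, c' t : ℝ) : ℂ) * U p
      = ∫ t in p..q, ((c' t : ℂ) * (U p - U t) - ((c t - c' t : ℝ) : ℂ) * U t) := by
    rw [← hs.integral_snd hcc le_rfl hpq le_rfl, ← intervalIntegral.integral_ofReal,
      ← intervalIntegral.integral_mul_const, ← intervalIntegral.integral_add]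
    · congr 1
      ext t
      push_cast
      ring
    all_goals exact Continuous.intervalIntegrable (by fun_prop) _ _
  rw [heq]
  refine (intervalIntegral.norm_integral_le_of_norm_le_const
    (C := (M * (η * M) + δ) * R) ?_).trans ?_
  · intro t ht
    rw [uIoc_of_le hpq] at ht
    have hm : t ∈ Icc p q := ⟨ht.1.le, ht.2⟩
    refine (norm_sub_le _ _).trans ?_
    rw [norm_mul, norm_mul, Complex.norm_real, Complex.norm_real, Real.norm_eq_abs,
      Real.norm_eq_abs, norm_sub_rev]
    have e1 := mul_le_mul (hc' t) (hlip t hm) (norm_nonneg _) hM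
    have e2 := mul_le_mul (hδ t) (hRU t hm) (norm_nonneg _) hδ0
    linarith
  · rw [abs_of_nonneg (by linarith)]
    exact mul_le_of_le_one_right (by positivity) hpq1

/-- The two-cell recurrence for exact transfer relations with errors `A₁, …, A₄` on the right
cell and `B₁, …, B₄` on the left cell. -/
lemma norm_mul_le_of_transfer {v₁ p₁ v₂ p₂ μ : ℝ} (hW : v₁ * p₂ - v₂ * p₁ = 1)
    {Ul sl Um sm U₀ s₀ Uh sh Ur sr : ℂ} {V d : ℝ} (hV : 1 ≤ V)
    (hv₁ : |v₁| ≤ V) (hp₁ : |p₁| ≤ V) (hv₂ : |v₂| ≤ V) (hp₂ : |p₂| ≤ V) (hμ : |μ| ≤ V)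
    (hA₁ : ‖(Uh * p₂ - sh * v₂) - U₀‖ ≤ d) (hA₂ : ‖(sh * v₁ - Uh * p₁) - s₀‖ ≤ d)
    (hA₃ : ‖Ur - Uh‖ ≤ d) (hA₄ : ‖sr - sh + μ * Uh‖ ≤ d)
    (hB₁ : ‖(Um * p₂ - sm * v₂) - Ul‖ ≤ d) (hB₂ : ‖(sm * v₁ - Um * p₁) - sl‖ ≤ d)
    (hB₃ : ‖U₀ - Um‖ ≤ d) (hB₄ : ‖s₀ - sm + μ * Um‖ ≤ d) :
    |v₁ + p₂ - v₂ * μ| * ‖U₀‖ ≤ ‖Ur‖ + ‖Ul‖ + 9 * (V ^ 2 * d) ∧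
    |v₁ + p₂ - v₂ * μ| * ‖s₀‖ ≤ ‖sr‖ + ‖sl‖ + 9 * (V ^ 2 * d) := by
  have hWc : (v₁ : ℂ) * p₂ - v₂ * p₁ = 1 := by exact_mod_cast hW
  have hd : 0 ≤ d := (norm_nonneg _).trans hA₁
  have hVV : V ≤ V ^ 2 := by nlinarith
  have hone : ∀ {X : ℂ}, ‖X‖ ≤ d → ‖X‖ ≤ V ^ 2 * d := fun hX =>
    hX.trans (le_mul_of_one_le_left hd (hV.trans hVV))
  have hlin : ∀ {a : ℝ} {X : ℂ}, |a| ≤ V → ‖X‖ ≤ d → ‖(a : ℂ) * X‖ ≤ V ^ 2 * d := by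
    intro a X ha hX
    rw [norm_mul, Complex.norm_real, Real.norm_eq_abs]
    exact mul_le_mul (ha.trans hVV) hX (norm_nonneg _) (by positivity)
  have hquad : ∀ {a b : ℝ} {X : ℂ}, |a| ≤ V → |b| ≤ V → ‖X‖ ≤ d →
      ‖(a : ℂ) * (b * X)‖ ≤ V ^ 2 * d := by
    intro a b X ha hb hX
    rw [norm_mul, norm_mul, Complex.norm_real, Complex.norm_real, Real.norm_eq_abs,
      Real.norm_eq_abs, pow_two, mul_assoc]
    exact mul_le_mul ha (mul_le_mul hb hX (norm_nonneg _) (by positivity)) (by positivity)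
      (by positivity)
  have hsum : ∀ {a b : ℂ} {x y : ℝ}, ‖a‖ ≤ x → ‖b‖ ≤ y → ‖a + b‖ ≤ x + y := fun ha hb =>
    (norm_add_le _ _).trans (add_le_add ha hb)
  have hdif : ∀ {a b : ℂ} {x y : ℝ}, ‖a‖ ≤ x → ‖b‖ ≤ y → ‖a - b‖ ≤ x + y := fun ha hb =>
    (norm_sub_le _ _).trans (add_le_add ha hb)
  have hF : ∀ X : ℂ, |v₁ + p₂ - v₂ * μ| * ‖X‖ = ‖((v₁ : ℂ) + p₂ - v₂ * μ) * X‖ := by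
    intro X
    rw [norm_mul, ← Real.norm_eq_abs, ← Complex.norm_real]
    push_cast
    rfl
  have hfin : 0 ≤ V ^ 2 * d := by positivity
  constructor
  · rw [hF]
    have heq : ((v₁ : ℂ) + p₂ - v₂ * μ) * U₀ = Ur + Ul
        - (v₁ * ((Uh * p₂ - sh * v₂) - U₀) + v₂ * ((sh * v₁ - Uh * p₁) - s₀) + (Ur - Uh)
          - p₂ * (U₀ - Um) + μ * (v₂ * (U₀ - Um)) + v₂ * (s₀ - sm + μ * Um)
          - ((Um * p₂ - sm * v₂) - Ul)) := by
      linear_combination Uh * hWc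
    rw [heq]
    have := hdif (hsum (le_refl ‖Ur‖) (le_refl ‖Ul‖))
      (hdif (hsum (hsum (hdif (hsum (hsum (hlin hv₁ hA₁) (hlin hv₂ hA₂)) (hone hA₃))
        (hlin hp₂ hB₃)) (hquad hμ hv₂ hB₃)) (hlin hv₂ hB₄)) (hone hB₁))
    linarith
  · rw [hF]
    have heq : ((v₁ : ℂ) + p₂ - v₂ * μ) * s₀ = sr + sl
        - (p₁ * ((Uh * p₂ - sh * v₂) - U₀) + p₂ * ((sh * v₁ - Uh * p₁) - s₀)
          - μ * (v₁ * ((Uh * p₂ - sh * v₂) - U₀)) - μ * (v₂ * ((sh * v₁ - Uh * p₁) - s₀))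
          + (sr - sh + μ * Uh) - μ * (v₁ * (U₀ - Um)) - v₁ * (s₀ - sm + μ * Um)
          + p₁ * (U₀ - Um) - ((sm * v₁ - Um * p₁) - sl)) := by
      linear_combination (sh - μ * Uh) * hWc
    rw [heq]
    have := hdif (hsum (le_refl ‖sr‖) (le_refl ‖sl‖))
      (hdif (hsum (hdif (hdif (hsum (hdif (hdif (hsum (hlin hp₁ hA₁) (hlin hp₂ hA₂))
        (hquad hμ hv₁ hA₁)) (hquad hμ hv₂ hA₂)) (hone hA₄)) (hquad hμ hv₁ hB₃))
        (hlin hv₁ hB₄)) (hlin hp₁ hB₃)) (hone hB₂))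
    linarith

/-- The limit system: periodic reference coefficients with the fundamental system of the soft
interval `[0, h]`. -/
structure LimitSystem (h M : ℝ) (b₀ c₀ c₁ v₁ p₁ v₂ p₂ : ℝ → ℝ) : Prop where
  cont_c₀ : Continuous c₀
  cont_c₁ : Continuous c₁
  abs_c₁ : ∀ t, |c₁ t| ≤ M
  per_b₀ : Function.Periodic b₀ 1
  per_c₀ : Function.Periodic c₀ 1
  per_c₁ : Function.Periodic c₁ 1
  deriv_v₁ : ∀ y ∈ Icc (0:ℝ) h, HasDerivAt v₁ (b₀ y * p₁ y) y
  deriv_p₁ : ∀ y ∈ Icc (0:ℝ) h, HasDerivAt p₁ (-(c₀ y * v₁ y)) y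
  deriv_v₂ : ∀ y ∈ Icc (0:ℝ) h, HasDerivAt v₂ (b₀ y * p₂ y) y
  deriv_p₂ : ∀ y ∈ Icc (0:ℝ) h, HasDerivAt p₂ (-(c₀ y * v₂ y)) y
  v₁_zero : v₁ 0 = 1
  p₁_zero : p₁ 0 = 0
  v₂_zero : v₂ 0 = 0
  p₂_zero : p₂ 0 = 1

/-- The nodal vector of a solution at the left end of the `z`-th cell. -/
def nodal (U s : ℝ → ℂ) (z : ℤ) : ℂ × ℂ := (U z, s z)

namespace LimitSystem

variable {h M : ℝ} {b₀ c₀ c₁ v₁ p₁ v₂ p₂ : ℝ → ℝ}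

lemma wronskian (hL : LimitSystem h M b₀ c₀ c₁ v₁ p₁ v₂ p₂) (hh0 : 0 ≤ h) :
    v₁ h * p₂ h - v₂ h * p₁ h = 1 := by
  have hd : ∀ y ∈ Icc (0:ℝ) h, HasDerivAt (fun y => v₁ y * p₂ y - v₂ y * p₁ y) 0 y := by
    intro y hy
    refine (((hL.deriv_v₁ y hy).mul (hL.deriv_p₂ y hy)).sub
      ((hL.deriv_v₂ y hy).mul (hL.deriv_p₁ y hy))).congr_deriv ?_
    ring
  have := constant_of_has_deriv_right_zero
    (fun y hy => (hd y hy).continuousAt.continuousWithinAt)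
    (fun y hy => (hd y ⟨hy.1, hy.2.le⟩).hasDerivWithinAt) h ⟨hh0, le_rfl⟩
  rw [this, hL.v₁_zero, hL.p₁_zero, hL.v₂_zero, hL.p₂_zero]
  norm_num

lemma exists_bound (hL : LimitSystem h M b₀ c₀ c₁ v₁ p₁ v₂ p₂) (hh0 : 0 ≤ h) :
    ∃ V : ℝ, 1 ≤ V ∧ (∀ y ∈ Icc (0:ℝ) h, |v₁ y| ≤ V) ∧ (∀ y ∈ Icc (0:ℝ) h, |v₂ y| ≤ V) ∧
      |p₁ h| ≤ V ∧ |p₂ h| ≤ V ∧ |∫ y in h..(1:ℝ), c₁ y| ≤ V := by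
  obtain ⟨V₁, hV₁⟩ := (isCompact_Icc (a := (0:ℝ)) (b := h)).exists_bound_of_continuousOn
    (f := v₁) fun y hy => (hL.deriv_v₁ y hy).continuousAt.continuousWithinAt
  obtain ⟨V₂, hV₂⟩ := (isCompact_Icc (a := (0:ℝ)) (b := h)).exists_bound_of_continuousOn
    (f := v₂) fun y hy => (hL.deriv_v₂ y hy).continuousAt.continuousWithinAt
  simp only [Real.norm_eq_abs] at hV₁ hV₂
  have h0 : (0:ℝ) ∈ Icc (0:ℝ) h := ⟨le_rfl, hh0⟩
  have g₁ := (abs_nonneg _).trans (hV₁ 0 h0)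
  have g₂ := (abs_nonneg _).trans (hV₂ 0 h0)
  have g₃ := abs_nonneg (p₁ h)
  have g₄ := abs_nonneg (p₂ h)
  have g₅ := abs_nonneg (∫ y in h..(1:ℝ), c₁ y)
  refine ⟨1 + V₁ + V₂ + |p₁ h| + |p₂ h| + |∫ y in h..(1:ℝ), c₁ y|, by linarith,
    fun y hy => ?_, fun y hy => ?_, by linarith, by linarith, by linarith⟩
  · linarith [hV₁ y hy]
  · linarith [hV₂ y hy]

lemma integral_stiff (hL : LimitSystem h M b₀ c₀ c₁ v₁ p₁ v₂ p₂) (z : ℤ) :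
    ∫ t in (z : ℝ) + h..z + 1, c₁ t = ∫ y in h..(1:ℝ), c₁ y := by
  have h1 := intervalIntegral.integral_comp_add_right (a := h) (b := 1) c₁ (z : ℝ)
  rw [add_comm (z : ℝ) h, add_comm (z : ℝ) 1, ← h1]
  congr 1
  ext y
  simpa using hL.per_c₁.int_mul z y

/-- Transfer relations over one cell, with errors. -/
lemma transfer (hL : LimitSystem h M b₀ c₀ c₁ v₁ p₁ v₂ p₂) (hh0 : 0 < h) (hh1 : h < 1)
    {V : ℝ} (hV₁ : ∀ y ∈ Icc (0:ℝ) h, |v₁ y| ≤ V) (hV₂ : ∀ y ∈ Icc (0:ℝ) h, |v₂ y| ≤ V)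
    {β η δ A B : ℝ} {d₀ b₁ d₁ : ℝ → ℝ} {U s : ℝ → ℂ} (hη : 0 ≤ η)
    (hc : CoefBounds β M η b₀ d₀ b₁ d₁) (hδ₀ : ∀ t, |d₀ t - c₀ t| ≤ δ)
    (hδ₁ : ∀ t, |d₁ t - c₁ t| ≤ δ) (hS : IsCellSolution h A B b₀ d₀ b₁ d₁ U s) {z : ℤ}
    (hz : OffDefect A B z) {R : ℝ} (hRU : ∀ t ∈ Icc (z : ℝ) (z + 1), ‖U t‖ ≤ R)
    (hRs : ∀ t ∈ Icc (z : ℝ) (z + 1), ‖s t‖ ≤ R) :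
    ‖(U (z + h) * p₂ h - s (z + h) * v₂ h) - U z‖ ≤ δ * R * V ∧
    ‖(s (z + h) * v₁ h - U (z + h) * p₁ h) - s z‖ ≤ δ * R * V ∧
    ‖U (z + 1) - U (z + h)‖ ≤ η * M * R ∧
    ‖s (z + 1) - s (z + h) + ((∫ y in h..(1:ℝ), c₁ y : ℝ) : ℂ) * U (z + h)‖
      ≤ (M * (η * M) + δ) * R := by
  have hM : 0 ≤ M := (abs_nonneg _).trans (hL.abs_c₁ 0)
  have hδ : 0 ≤ δ := (abs_nonneg _).trans (hδ₀ 0)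
  have h0 := hS.soft_system (z := z) (p := z) (q := z + h) le_rfl le_rfl
    (hz.imp (fun h => by linarith) id)
  have h1 := hS.stiff_system (z := z) (p := z + h) (q := z + 1) le_rfl le_rfl
    (hz.imp id (fun h => by linarith))
  have hbz : ∀ y, b₀ (y + z) = b₀ y := fun y => by simpa using hL.per_b₀.int_mul z y
  have hcz : ∀ y, c₀ (y + z) = c₀ y := fun y => by simpa using hL.per_c₀.int_mul z y
  have hRU0 : ∀ t ∈ Icc (z : ℝ) (z + h), ‖U t‖ ≤ R := fun t ht =>
    hRU t ⟨ht.1, by linarith [ht.2]⟩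
  have e₁ := h0.norm_pairing_sub_le hh0 hh1.le hc.cont_c₀ hL.cont_c₀ hL.deriv_v₂ hL.deriv_p₂
    hbz hcz hδ hRU0 hδ₀ hV₂
  have e₂ := h0.norm_pairing_sub_le hh0 hh1.le hc.cont_c₀ hL.cont_c₀ hL.deriv_v₁ hL.deriv_p₁
    hbz hcz hδ hRU0 hδ₀ hV₁
  have e₃ := h1.norm_stiff_jump_le (by linarith) (by linarith) hc.cont_b₁ hc.cont_c₁
    hL.cont_c₁ hη hM hc.abs_b₁_le hL.abs_c₁ hδ₁ (R := R)
    (fun t ht => hRU t ⟨by linarith [ht.1], ht.2⟩)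
    (fun t ht => hRs t ⟨by linarith [ht.1], ht.2⟩)
  rw [hL.integral_stiff] at e₃
  refine ⟨?_, ?_, e₃⟩
  · rw [hL.v₂_zero, hL.p₂_zero] at e₁
    simpa using e₁
  · rw [hL.v₁_zero, hL.p₁_zero, ← norm_neg] at e₂
    refine le_trans (le_of_eq ?_) e₂
    congr 1
    push_cast
    ring

/-- The nodal vectors outside the defect almost satisfy a three-term recurrence. -/
lemma exists_recurrence (hL : LimitSystem h M b₀ c₀ c₁ v₁ p₁ v₂ p₂) (hh0 : 0 < h)
    (hh1 : h < 1) :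
    ∃ C > 0, ∀ (β η δ A B : ℝ) (d₀ b₁ d₁ : ℝ → ℝ) (U s : ℝ → ℂ), 0 ≤ η →
      CoefBounds β M η b₀ d₀ b₁ d₁ → (∀ t, |d₀ t - c₀ t| ≤ δ) → (∀ t, |d₁ t - c₁ t| ≤ δ) →
      IsCellSolution h A B b₀ d₀ b₁ d₁ U s → ∀ z : ℤ, OffDefect A B (z - 1) →
      OffDefect A B z →
      |v₁ h + p₂ h - v₂ h * ∫ y in h..(1:ℝ), c₁ y| * ‖nodal U s z‖
        ≤ ‖nodal U s (z + 1)‖ + ‖nodal U s (z - 1)‖ + C * (η + δ) * ‖nodal U s z‖ := by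
  obtain ⟨V, hV, hV₁, hV₂, hVp₁, hVp₂, hVμ⟩ := hL.exists_bound hh0.le
  have hM : 0 ≤ M := (abs_nonneg _).trans (hL.abs_c₁ 0)
  set E := Real.exp (2 * M) with hE
  have hE0 : 0 < E := Real.exp_pos _
  refine ⟨9 * (V ^ 2 * ((V + M + M * M + 1) * (2 * E))), by positivity, ?_⟩
  intro β η δ A B d₀ b₁ d₁ U s hη hc hδ₀ hδ₁ hS z hz' hz
  have hδ : 0 ≤ δ := (abs_nonneg _).trans (hδ₀ 0)
  set r := ‖nodal U s z‖ with hr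
  have hr0 : 0 ≤ r := norm_nonneg _
  have hUr : ‖U z‖ ≤ r := norm_fst_le (nodal U s z)
  have hsr : ‖s z‖ ≤ r := norm_snd_le (nodal U s z)
  have hbound : ∀ (z' : ℤ), OffDefect A B z' → (z : ℝ) ∈ Icc (z' : ℝ) (z' + 1) →
      ∀ t ∈ Icc (z' : ℝ) (z' + 1), ‖U t‖ ≤ 2 * E * r ∧ ‖s t‖ ≤ 2 * E * r := by
    intro z' hz' hmem t ht
    have h1 := hS.energy_cell_le hc hh0 hh1 hz' hmem ht
    have h2 : ‖U t‖ ^ 2 + ‖s t‖ ^ 2 ≤ (2 * E * r) ^ 2 := by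
      have hUr2 := pow_le_pow_left₀ (norm_nonneg _) hUr 2
      have hsr2 := pow_le_pow_left₀ (norm_nonneg _) hsr 2
      have := mul_le_mul_of_nonneg_left (add_le_add hUr2 hsr2) (sq_nonneg E)
      nlinarith [mul_nonneg (sq_nonneg E) (sq_nonneg r)]
    have h3 : 0 ≤ 2 * E * r := by positivity
    exact ⟨abs_le_of_sq_le_sq' (by nlinarith [sq_nonneg ‖s t‖]) h3 |>.2,
      abs_le_of_sq_le_sq' (by nlinarith [sq_nonneg ‖U t‖]) h3 |>.2⟩
  have hb := hbound z hz ⟨le_rfl, by linarith⟩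
  have hb' := hbound (z - 1) hz' ⟨by push_cast; linarith, by push_cast; linarith⟩
  obtain ⟨a₁, a₂, a₃, a₄⟩ := hL.transfer hh0 hh1 hV₁ hV₂ hη hc hδ₀ hδ₁ hS hz
    (fun t ht => (hb t ht).1) (fun t ht => (hb t ht).2)
  obtain ⟨e₁, e₂, e₃, e₄⟩ := hL.transfer hh0 hh1 hV₁ hV₂ hη hc hδ₀ hδ₁ hS hz'
    (fun t ht => (hb' t ht).1) (fun t ht => (hb' t ht).2)
  set d := (η + δ) * (V + M + M * M + 1) * (2 * E * r) with hd
  have hR : 0 ≤ 2 * E * r := by positivity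
  have l₁ : δ * (2 * E * r) * V ≤ d := by
    have : δ * V ≤ (η + δ) * (V + M + M * M + 1) :=
      mul_le_mul (by linarith) (by nlinarith) (by linarith) (by linarith)
    nlinarith [mul_le_mul_of_nonneg_right this hR]
  have l₂ : η * M * (2 * E * r) ≤ d :=
    mul_le_mul_of_nonneg_right
      (mul_le_mul (by linarith) (by nlinarith) hM (by linarith)) hR
  have l₃ : (M * (η * M) + δ) * (2 * E * r) ≤ d := by
    refine mul_le_mul_of_nonneg_right ?_ hR
    have i₁ : 0 ≤ η * (V + M + 1) := by positivity
    have i₂ : 0 ≤ δ * (V + M + M * M) := by positivity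
    nlinarith
  have hz1 : ((z - 1 : ℤ) : ℝ) + 1 = z := by push_cast; ring
  rw [hz1] at e₃ e₄
  obtain ⟨f₁, f₂⟩ := norm_mul_le_of_transfer (hL.wronskian hh0.le) hV
    (hV₁ h ⟨hh0.le, le_rfl⟩) hVp₁ (hV₂ h ⟨hh0.le, le_rfl⟩) hVp₂ hVμ
    (a₁.trans l₁) (a₂.trans l₁) (a₃.trans l₂) (a₄.trans l₃)
    (e₁.trans l₁) (e₂.trans l₁) (e₃.trans l₂) (e₄.trans l₃)
  have hUp : ‖U (z + 1)‖ ≤ ‖nodal U s (z + 1)‖ := by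
    simp [nodal]
  have hsp : ‖s (z + 1)‖ ≤ ‖nodal U s (z + 1)‖ := by
    simp [nodal]
  have hUm : ‖U (z - 1 : ℤ)‖ ≤ ‖nodal U s (z - 1)‖ := norm_fst_le (nodal U s (z - 1))
  have hsm : ‖s (z - 1 : ℤ)‖ ≤ ‖nodal U s (z - 1)‖ := norm_snd_le (nodal U s (z - 1))
  have hCd : 9 * (V ^ 2 * ((V + M + M * M + 1) * (2 * E))) * (η + δ) * r = 9 * (V ^ 2 * d) := by
    rw [hd]
    ring
  rw [hCd]
  rcases le_total ‖U z‖ ‖s z‖ with hle | hle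
  · have : r = ‖s z‖ := by simp [hr, nodal, Prod.norm_def, hle]
    rw [this]
    linarith
  · have : r = ‖U z‖ := by simp [hr, nodal, Prod.norm_def, hle]
    rw [this]
    linarith

end LimitSystem

/-- All cells within distance `J` of the `z`-th one avoid the defect. -/
def DeepOffDefect (A B : ℝ) (J : ℕ) (z : ℤ) : Prop := ∀ i : ℤ, |i - z| ≤ J → OffDefect A B i

open Classical in
/-- A three-term recurrence with a hyperbolic coefficient forces geometric decay of the total
mass away from the defect. -/
lemma tsum_deep_le {E : Type*} [SeminormedAddCommGroup E] {A B τ : ℝ} (hτ : 2 < τ) {X : ℤ → E}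
    (hrec : ∀ z : ℤ, OffDefect A B (z - 1) → OffDefect A B z →
      τ * ‖X z‖ ≤ ‖X (z + 1)‖ + ‖X (z - 1)‖) (J : ℕ) :
    ∑' z : ℤ, (if DeepOffDefect A B J z then ENNReal.ofReal (‖X z‖ ^ 2) else 0)
      ≤ ENNReal.ofReal (4 / τ ^ 2) ^ J *
        ∑' z : ℤ, (if OffDefect A B z then ENNReal.ofReal (‖X z‖ ^ 2) else 0) := by
  set m : ℤ → ENNReal := fun z => ENNReal.ofReal (‖X z‖ ^ 2) with hm
  have hstep : ∀ z : ℤ, OffDefect A B (z - 1) → OffDefect A B z →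
      m z ≤ ENNReal.ofReal (2 / τ ^ 2) * (m (z + 1) + m (z - 1)) := by
    intro z h1 h2
    rw [hm]
    simp only
    rw [← ENNReal.ofReal_add (by positivity) (by positivity),
      ← ENNReal.ofReal_mul (by positivity)]
    apply ENNReal.ofReal_le_ofReal
    rw [div_mul_eq_mul_div, le_div_iff₀ (by positivity)]
    have h3 := hrec z h1 h2
    have h4 : (τ * ‖X z‖) ^ 2 ≤ (‖X (z + 1)‖ + ‖X (z - 1)‖) ^ 2 :=
      pow_le_pow_left₀ (by positivity) h3 2
    nlinarith [sq_nonneg (‖X (z + 1)‖ - ‖X (z - 1)‖)]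
  induction J with
  | zero =>
    rw [pow_zero, one_mul]
    refine ENNReal.tsum_le_tsum fun z => ?_
    split_ifs with h1 h2
    · exact le_rfl
    · exact absurd (h1 z (by simp)) h2
    · exact zero_le
    · exact le_rfl
  | succ J ih =>
    set T : ℤ → ENNReal := fun z => if DeepOffDefect A B J z then m z else 0 with hT
    have hle : ∀ z : ℤ, (if DeepOffDefect A B (J + 1) z then m z else 0)
        ≤ ENNReal.ofReal (2 / τ ^ 2) * (T (z + 1) + T (z - 1)) := by
      intro z
      split_ifs with hz
      · have hp : DeepOffDefect A B J (z + 1) := fun i hi => hz i (by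
          rw [abs_le] at *
          push_cast
          omega)
        have hq : DeepOffDefect A B J (z - 1) := fun i hi => hz i (by
          rw [abs_le] at *
          push_cast
          omega)
        simp only [hT, hp, hq, if_true]
        exact hstep z (hz _ (by rw [abs_le]; push_cast; omega))
          (hz _ (by rw [abs_le]; push_cast; omega))
      · exact zero_le
    calc ∑' z : ℤ, (if DeepOffDefect A B (J + 1) z then m z else 0)
        ≤ ∑' z : ℤ, ENNReal.ofReal (2 / τ ^ 2) * (T (z + 1) + T (z - 1)) :=
          ENNReal.tsum_le_tsum hle
      _ = ENNReal.ofReal (2 / τ ^ 2) * (∑' z, T z + ∑' z, T z) := by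
          rw [ENNReal.tsum_mul_left, ENNReal.tsum_add]
          congr 2
          · exact (Equiv.addRight (1 : ℤ)).tsum_eq T
          · exact (Equiv.subRight (1 : ℤ)).tsum_eq T
      _ = ENNReal.ofReal (4 / τ ^ 2) * ∑' z, T z := by
          rw [← two_mul, ← mul_assoc]
          congr 1
          rw [← ENNReal.ofReal_ofNat 2, ← ENNReal.ofReal_mul (by positivity)]
          congr 1
          ring
      _ ≤ ENNReal.ofReal (4 / τ ^ 2) * (ENNReal.ofReal (4 / τ ^ 2) ^ J *
          ∑' z : ℤ, (if OffDefect A B z then m z else 0)) := by gcongr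
      _ = _ := by rw [pow_succ' (ENNReal.ofReal (4 / τ ^ 2)) J, mul_assoc]

lemma continuous_floor_glue {E : Type*} [TopologicalSpace E] {φ : ℤ → ℝ → E}
    (hφ : ∀ z, Continuous (φ z)) (hglue : ∀ z : ℤ, φ z (z + 1) = φ (z + 1) (z + 1)) :
    Continuous fun t => φ ⌊t⌋ t := by
  rw [continuous_iff_continuousAt]
  intro t
  rw [continuousAt_iff_continuous_left'_right']
  constructor
  · have hev : (fun x => φ ⌊x⌋ x) =ᶠ[𝓝[<] t] φ (⌈t⌉ - 1) := by
      have := tendsto_floor_left_pure_ceil_sub_one t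
      rw [tendsto_pure] at this
      filter_upwards [this] with x hx
      rw [hx]
    have hval : φ ⌊t⌋ t = φ (⌈t⌉ - 1) t := by
      by_cases ht : (⌊t⌋ : ℝ) = t
      · have h1 : ⌈t⌉ = ⌊t⌋ := by
          rw [← ht, Int.ceil_intCast, Int.floor_intCast]
        have h2 := hglue (⌈t⌉ - 1)
        rw [h1] at h2 ⊢
        push_cast at h2
        rw [sub_add_cancel, ht, sub_add_cancel] at h2
        exact h2.symm
      · have h1 : ⌈t⌉ = ⌊t⌋ + 1 := by
          rw [Int.ceil_eq_iff]
          push_cast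
          exact ⟨by linarith [lt_of_le_of_ne (Int.floor_le t) ht], (Int.lt_floor_add_one t).le⟩
        rw [h1, add_sub_cancel_right]
    have hc : ContinuousWithinAt (φ (⌈t⌉ - 1)) (Iio t) t :=
      (hφ _).continuousAt.continuousWithinAt
    exact hc.congr_of_eventuallyEq hev hval
  · have hev : (fun x => φ ⌊x⌋ x) =ᶠ[𝓝[≥] t] φ ⌊t⌋ := by
      have := tendsto_floor_right_pure_floor t
      rw [tendsto_pure] at this
      filter_upwards [this] with x hx
      rw [hx]
    have hc : ContinuousWithinAt (φ ⌊t⌋) (Ici t) t := (hφ _).continuousAt.continuousWithinAt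
    exact (hc.congr_of_eventuallyEq hev rfl).mono Ioi_subset_Ici_self

/-- On the `z`-th cell: `f - c z` on the stiff part, linear interpolation on the soft part. -/
noncomputable def correctorCell (h : ℝ) (f : ℝ → ℂ) (c : ℤ → ℂ) (z : ℤ) (t : ℝ) : ℂ :=
  if t ≤ z + h then
    ((1 - (t - z) / h : ℝ) : ℂ) * (f z - c (z - 1)) + (((t - z) / h : ℝ) : ℂ) * (f (z + h) - c z)
  else f t - c z

/-- The continuous function given by `correctorCell` on each cell. -/
noncomputable def corrector (h : ℝ) (f : ℝ → ℂ) (c : ℤ → ℂ) (t : ℝ) : ℂ :=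
  correctorCell h f c ⌊t⌋ t

section corrector

variable {h : ℝ} {f : ℝ → ℂ} {c : ℤ → ℂ}

lemma continuous_corrector (hh0 : 0 < h) (hh1 : h < 1) (hf : Continuous f) :
    Continuous (corrector h f c) := by
  apply continuous_floor_glue
  · intro z
    unfold correctorCell
    refine Continuous.if_le (by fun_prop) (by fun_prop) (by fun_prop) (by fun_prop) ?_
    intro t ht
    rw [ht, add_sub_cancel_left, div_self hh0.ne']
    simp
  · intro z
    unfold correctorCell
    rw [if_neg (by linarith), if_pos (by push_cast; linarith)]
    push_cast
    simp

lemma norm_correctorCell_le (hh0 : 0 < h) (hh1 : h < 1) {G : ℤ → ℝ}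
    (hG : ∀ z : ℤ, ∀ t ∈ Icc ((z : ℝ) + h) (z + 1), ‖f t - c z‖ ≤ G z) {z : ℤ} {t : ℝ}
    (ht : t ∈ Icc (z : ℝ) (z + 1)) : ‖correctorCell h f c z t‖ ≤ G (z - 1) + G z := by
  have h1 : ‖f z - c (z - 1)‖ ≤ G (z - 1) :=
    hG (z - 1) z ⟨by push_cast; linarith, by push_cast; linarith⟩
  have h2 : ‖f (z + h) - c z‖ ≤ G z := hG z (z + h) ⟨le_rfl, by linarith⟩
  have g1 := (norm_nonneg _).trans h1
  have g2 := (norm_nonneg _).trans h2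
  unfold correctorCell
  split_ifs with hth
  · have hr0 : 0 ≤ (t - z) / h := div_nonneg (by linarith [ht.1]) hh0.le
    have hr1 : (t - z) / h ≤ 1 := by
      rw [div_le_one hh0]
      linarith
    refine (norm_add_le _ _).trans (add_le_add ?_ ?_)
    · rw [norm_mul, Complex.norm_real, Real.norm_eq_abs, abs_of_nonneg (by linarith)]
      nlinarith [norm_nonneg (f z - c (z - 1))]
    · rw [norm_mul, Complex.norm_real, Real.norm_eq_abs, abs_of_nonneg hr0]
      nlinarith [norm_nonneg (f (z + h) - c z)]
  · have := hG z t ⟨by linarith, ht.2⟩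
    linarith

lemma corrector_eventuallyEq {z : ℤ} {t : ℝ} (ht : t ∈ Ioo (z : ℝ) (z + 1)) :
    corrector h f c =ᶠ[𝓝 t] correctorCell h f c z := by
  filter_upwards [isOpen_Ioo.mem_nhds ht] with x hx
  rw [corrector, Int.floor_eq_iff.2 ⟨hx.1.le, hx.2⟩]

lemma exists_hasDerivAt_corrector_soft (hh0 : 0 < h) (hh1 : h < 1) {G : ℤ → ℝ}
    (hG : ∀ z : ℤ, ∀ t ∈ Icc ((z : ℝ) + h) (z + 1), ‖f t - c z‖ ≤ G z) {z : ℤ} {t : ℝ}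
    (ht : t ∈ Ioo (z : ℝ) (z + h)) :
    ∃ d, HasDerivAt (corrector h f c) d t ∧ ‖d‖ ≤ (G (z - 1) + G z) / h := by
  have h1 : ‖f z - c (z - 1)‖ ≤ G (z - 1) :=
    hG (z - 1) z ⟨by push_cast; linarith, by push_cast; linarith⟩
  have h2 : ‖f (z + h) - c z‖ ≤ G z := hG z (z + h) ⟨le_rfl, by linarith⟩
  refine ⟨((-(1 / h) : ℝ) : ℂ) * (f z - c (z - 1)) + ((1 / h : ℝ) : ℂ) * (f (z + h) - c z),
    ?_, ?_⟩
  · have hev : corrector h f c =ᶠ[𝓝 t] fun t => ((1 - (t - z) / h : ℝ) : ℂ) * (f z - c (z - 1))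
        + (((t - z) / h : ℝ) : ℂ) * (f (z + h) - c z) := by
      filter_upwards [corrector_eventuallyEq (h := h) (f := f) (c := c)
        (⟨ht.1, by linarith [ht.2]⟩ : t ∈ Ioo (z : ℝ) (z + 1)), isOpen_Iio.mem_nhds ht.2]
        with x hx hxh
      rw [hx, correctorCell, if_pos (le_of_lt hxh)]
    refine HasDerivAt.congr_of_eventuallyEq ?_ hev
    have hlin : HasDerivAt (fun t : ℝ => (t - z) / h) (1 / h) t :=
      ((hasDerivAt_id t).sub_const _).div_const h
    exact ((hlin.const_sub 1).ofReal_comp.mul_const _).add (hlin.ofReal_comp.mul_const _)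
  · refine (norm_add_le _ _).trans ?_
    rw [norm_mul, norm_mul, Complex.norm_real, Complex.norm_real, norm_neg, Real.norm_eq_abs,
      abs_of_pos (by positivity), add_div]
    rw [one_div_mul_eq_div, one_div_mul_eq_div]
    gcongr

lemma hasDerivAt_corrector_stiff (hh0 : 0 < h) {z : ℤ} {t : ℝ}
    (ht : t ∈ Ioo ((z : ℝ) + h) (z + 1)) {d : ℂ} (hf : HasDerivAt f d t) :
    HasDerivAt (corrector h f c) d t := by
  have hev : corrector h f c =ᶠ[𝓝 t] fun t => f t - c z := by
    filter_upwards [corrector_eventuallyEq (h := h) (f := f) (c := c)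
      (⟨by linarith [ht.1], ht.2⟩ : t ∈ Ioo (z : ℝ) (z + 1)), isOpen_Ioi.mem_nhds ht.1]
      with x hx hxh
    rw [hx, correctorCell, if_neg (not_le.2 hxh)]
  exact (hf.sub_const _).congr_of_eventuallyEq hev

end corrector

/-- The function subtracted from `U`, up to cell-wise constants, on the stiff part. -/
noncomputable def offDefectPart (A B : ℝ) (U : ℝ → ℂ) (t : ℝ) : ℂ := U (min t A) + U (max t B)

/-- The value of `offDefectPart` from which the `z`-th stiff interval is measured. -/
noncomputable def stiffLevel (h A B : ℝ) (U : ℝ → ℂ) (z : ℤ) : ℂ :=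
  U (min ((z : ℝ) + 1) A) + U (max ((z : ℝ) + h) B)

lemma hasDerivAt_offDefectPart {A B : ℝ} (hAB : A < B) {U : ℝ → ℂ} {d : ℂ} {t : ℝ}
    (ht : t < A ∨ B < t) (hU : HasDerivAt U d t) : HasDerivAt (offDefectPart A B U) d t := by
  rcases ht with ht | ht
  · have hev : offDefectPart A B U =ᶠ[𝓝 t] fun t => U t + U B := by
      filter_upwards [isOpen_Iio.mem_nhds ht] with x hx
      rw [offDefectPart, min_eq_left (le_of_lt hx), max_eq_right (le_of_lt (lt_trans hx hAB))]
    exact (hU.add_const _).congr_of_eventuallyEq hev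
  · have hev : offDefectPart A B U =ᶠ[𝓝 t] fun t => U A + U t := by
      filter_upwards [isOpen_Ioi.mem_nhds ht] with x hx
      rw [offDefectPart, min_eq_right (le_of_lt (lt_trans hAB hx)), max_eq_left (le_of_lt hx)]
    exact (hU.const_add _).congr_of_eventuallyEq hev

lemma hasDerivAt_offDefectPart_zero {A B : ℝ} {U : ℝ → ℂ} {t : ℝ} (ht : t ∈ Ioo A B) :
    HasDerivAt (offDefectPart A B U) 0 t := by
  have hev : offDefectPart A B U =ᶠ[𝓝 t] fun _ => U A + U B := by
    filter_upwards [isOpen_Ioo.mem_nhds ht] with x hx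
    rw [offDefectPart, min_eq_right hx.1.le, max_eq_right hx.2.le]
  exact (hasDerivAt_const _ _).congr_of_eventuallyEq hev

/-- The corrector of a solution of the rescaled problem, its size and that of its derivative. -/
lemma exists_corrector_bounds {β M h : ℝ} (hβ : 0 < β) (hM : 0 ≤ M) (hh0 : 0 < h) (hh1 : h < 1) :
    ∃ C > 0, ∀ (η A B : ℝ) (b₀ c₀ b₁ c₁ : ℝ → ℝ) (U s : ℝ → ℂ), 0 ≤ η → A < B →
      CoefBounds β M η b₀ c₀ b₁ c₁ → IsCellSolution h A B b₀ c₀ b₁ c₁ U s →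
      ∃ ω : ℝ → ℂ, Continuous ω ∧
      (∀ (z : ℤ) (t : ℝ), t ∈ Ico (z : ℝ) (z + 1) →
        ‖ω t‖ ^ 2 ≤ C * η ^ 2 * (cellMass U (z - 1) + cellMass U z + cellMass U (z + 1))) ∧
      (∀ (z : ℤ) (t : ℝ), t ∈ Ioo (z : ℝ) (z + 1) → t ≠ z + h → t ≠ A → t ≠ B →
        ∃ d, HasDerivAt ω d t ∧
          ‖d‖ ^ 2 ≤ C * η ^ 2 * (cellMass U (z - 1) + cellMass U z + cellMass U (z + 1))) ∧
      (∀ (z : ℤ) (t : ℝ), t ∈ Ioo ((z : ℝ) + h) (z + 1) → t < A ∨ B < t →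
        HasDerivAt ω ((b₁ t : ℂ) * s t) t) := by
  obtain ⟨K, hK, hen⟩ := exists_energy_le_cellMass hβ hM hh0 hh1
  refine ⟨6 * (M ^ 2 * K) / h ^ 2 + 1, by positivity, ?_⟩
  intro η A B b₀ c₀ b₁ c₁ U s hη hAB hc hS
  have hen := hen η A B b₀ c₀ b₁ c₁ U s hc hS
  have hUc := hS.cont_fst
  set r : ℤ → ℝ := fun z => Real.sqrt (cellMass U z) with hr
  set L : ℝ := η * M * Real.sqrt K with hL
  have hr0 : ∀ z, 0 ≤ r z := fun z => Real.sqrt_nonneg _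
  have hr2 : ∀ z, r z ^ 2 = cellMass U z := fun z => Real.sq_sqrt (cellMass_nonneg U z)
  have hηM : 0 ≤ η * M := mul_nonneg hη hM
  have hL0 : 0 ≤ L := mul_nonneg hηM (Real.sqrt_nonneg _)
  have hs : ∀ {a b : ℂ} {m : ℝ}, ‖a‖ ^ 2 + ‖b‖ ^ 2 ≤ K * m →
      ‖b‖ ≤ Real.sqrt K * Real.sqrt m := by
    intro a b m hab
    rw [← Real.sqrt_mul hK.le]
    apply Real.le_sqrt_of_sq_le
    nlinarith [sq_nonneg ‖a‖]
  have hf : Continuous (offDefectPart A B U) := by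
    unfold offDefectPart
    fun_prop
  have hstiff : ∀ z : ℤ, ∀ t ∈ Icc ((z : ℝ) + h) (z + 1),
      ‖offDefectPart A B U t - stiffLevel h A B U z‖ ≤ L * (r z + r (z + 1)) := by
    intro z t ht
    have h1 : ‖U (min t A) - U (min ((z : ℝ) + 1) A)‖ ≤ L * r z := by
      rcases le_total A t with hAt | hAt
      · rw [min_eq_right hAt, min_eq_right (hAt.trans ht.2), sub_self, norm_zero]
        exact mul_nonneg hL0 (hr0 z)
      · rw [min_eq_left hAt, norm_sub_rev]
        have hle : t ≤ min ((z : ℝ) + 1) A := le_min ht.2 hAt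
        have hsys := hS.stiff_system (z := z) (p := t) (q := min ((z : ℝ) + 1) A) ht.1
          (min_le_left _ _) (Or.inl (min_le_right _ _))
        have := hsys.norm_sub_fst_le hc.cont_b₁ hηM hc.abs_b₁_le
          (S := Real.sqrt K * r z)
          (fun y hy => hs ((hen z).2.2 y ⟨ht.1.trans hy.1, hy.2.trans (min_le_left _ _)⟩
            (hy.2.trans (min_le_right _ _)))) le_rfl hle le_rfl
        refine this.trans ?_
        rw [← mul_assoc]
        refine mul_le_of_le_one_right (mul_nonneg hL0 (hr0 z)) ?_
        linarith [min_le_left ((z : ℝ) + 1) A, ht.1]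
    have h2 : ‖U (max t B) - U (max ((z : ℝ) + h) B)‖ ≤ L * r (z + 1) := by
      rcases le_total t B with hBt | hBt
      · rw [max_eq_right hBt, max_eq_right (ht.1.trans hBt), sub_self, norm_zero]
        exact mul_nonneg hL0 (hr0 _)
      · rw [max_eq_left hBt]
        have hle : max ((z : ℝ) + h) B ≤ t := max_le ht.1 hBt
        have hsys := hS.stiff_system (z := z) (p := max ((z : ℝ) + h) B) (q := t) (le_max_left _ _)
          ht.2 (Or.inr (le_max_right _ _))
        have := hsys.norm_sub_fst_le hc.cont_b₁ hηM hc.abs_b₁_le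
          (S := Real.sqrt K * r (z + 1))
          (fun y hy => hs ((hen z).2.1 y ⟨(le_max_left _ _).trans hy.1, hy.2.trans ht.2⟩
            ((le_max_right _ _).trans hy.1))) le_rfl hle le_rfl
        refine this.trans ?_
        rw [← mul_assoc]
        refine mul_le_of_le_one_right (mul_nonneg hL0 (hr0 _)) ?_
        linarith [le_max_left ((z : ℝ) + h) B, ht.2]
    calc _ = ‖(U (min t A) - U (min ((z : ℝ) + 1) A)) +
            (U (max t B) - U (max ((z : ℝ) + h) B))‖ := by
          unfold offDefectPart stiffLevel
          congr 1
          ring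
      _ ≤ _ := (norm_add_le _ _).trans (by linarith)
  have hsq : ∀ {z : ℤ} {d : ℂ},
      ‖d‖ ≤ (L * (r (z - 1) + r (z - 1 + 1)) + L * (r z + r (z + 1))) / h →
      ‖d‖ ^ 2 ≤ (6 * (M ^ 2 * K) / h ^ 2 + 1) * η ^ 2 *
        (cellMass U (z - 1) + cellMass U z + cellMass U (z + 1)) := by
    intro z d hd
    rw [sub_add_cancel] at hd
    have h1 := pow_le_pow_left₀ (norm_nonneg d) hd 2
    refine h1.trans ?_
    have hLsq : L ^ 2 = η ^ 2 * (M ^ 2 * K) := by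
      rw [hL, mul_pow, mul_pow, Real.sq_sqrt hK.le, mul_assoc]
    have h2 : (r (z - 1) + 2 * r z + r (z + 1)) ^ 2
        ≤ 6 * (cellMass U (z - 1) + cellMass U z + cellMass U (z + 1)) := by
      rw [← hr2, ← hr2, ← hr2]
      nlinarith [sq_nonneg (2 * r (z - 1) - r z), sq_nonneg (r (z - 1) - r (z + 1)),
        sq_nonneg (r z - 2 * r (z + 1))]
    calc _ = η ^ 2 * ((M ^ 2 * K) / h ^ 2) * (r (z - 1) + 2 * r z + r (z + 1)) ^ 2 := by
          rw [div_pow, ← mul_add, mul_pow, hLsq]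
          ring
      _ ≤ η ^ 2 * ((M ^ 2 * K) / h ^ 2) *
          (6 * (cellMass U (z - 1) + cellMass U z + cellMass U (z + 1))) := by gcongr
      _ ≤ _ := by
          have := cellMass_nonneg U (z - 1)
          have := cellMass_nonneg U z
          have := cellMass_nonneg U (z + 1)
          have : 0 ≤ η ^ 2 * (cellMass U (z - 1) + cellMass U z + cellMass U (z + 1)) := by
            positivity
          linear_combination this
  have hlediv : ∀ {x : ℝ}, 0 ≤ x → x ≤ x / h := fun hx => by
    rw [le_div_iff₀ hh0]
    nlinarith
  refine ⟨corrector h (offDefectPart A B U) (stiffLevel h A B U),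
    continuous_corrector hh0 hh1 hf, ?_, ?_, ?_⟩
  · intro z t ht
    apply hsq
    rw [corrector, Int.floor_eq_iff.2 ht]
    refine (norm_correctorCell_le hh0 hh1 hstiff ⟨ht.1, ht.2.le⟩).trans (hlediv ?_)
    exact add_nonneg (mul_nonneg hL0 (add_nonneg (hr0 _) (hr0 _)))
      (mul_nonneg hL0 (add_nonneg (hr0 _) (hr0 _)))
  · intro z t ht hzh hA hB
    rcases lt_or_gt_of_ne hzh with hlt | hgt
    · obtain ⟨d, hd, hdn⟩ := exists_hasDerivAt_corrector_soft hh0 hh1 hstiff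
        (⟨ht.1, hlt⟩ : t ∈ Ioo (z : ℝ) (z + h))
      exact ⟨d, hd, hsq hdn⟩
    · have htz : t ∈ Ioo ((z : ℝ) + h) (z + 1) := ⟨hgt, ht.2⟩
      have hdle : ∀ {d : ℂ}, ‖d‖ ≤ L * r z + L * r (z + 1) →
          ‖d‖ ≤ (L * (r (z - 1) + r (z - 1 + 1)) + L * (r z + r (z + 1))) / h := by
        intro d hd
        have h0 : 0 ≤ L * (r (z - 1) + r (z - 1 + 1)) :=
          mul_nonneg hL0 (add_nonneg (hr0 _) (hr0 _))
        have h1 : 0 ≤ L * (r z + r (z + 1)) := mul_nonneg hL0 (add_nonneg (hr0 _) (hr0 _))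
        refine le_trans ?_ (hlediv (add_nonneg h0 h1))
        linarith
      have hz0 := mul_nonneg hL0 (hr0 z)
      have hz1 := mul_nonneg hL0 (hr0 (z + 1))
      have hbs : ∀ {m : ℝ}, ‖s t‖ ≤ Real.sqrt K * m → ‖(b₁ t : ℂ) * s t‖ ≤ L * m := by
        intro m hm
        rw [norm_mul, Complex.norm_real, Real.norm_eq_abs, hL, mul_assoc]
        exact mul_le_mul (hc.abs_b₁_le t) hm (norm_nonneg _) hηM
      rcases lt_or_gt_of_ne hA with hA | hA
      · refine ⟨_, hasDerivAt_corrector_stiff hh0 htz (hasDerivAt_offDefectPart hAB (Or.inl hA)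
          (hS.stiff z t htz (Or.inl hA)).1), hsq (hdle ?_)⟩
        have := hbs (hs ((hen z).2.2 t ⟨hgt.le, ht.2.le⟩ hA.le))
        linarith
      rcases lt_or_gt_of_ne hB with hB | hB
      · refine ⟨_, hasDerivAt_corrector_stiff hh0 htz (hasDerivAt_offDefectPart_zero ⟨hA, hB⟩),
          hsq (hdle ?_)⟩
        rw [norm_zero]
        linarith
      · refine ⟨_, hasDerivAt_corrector_stiff hh0 htz (hasDerivAt_offDefectPart hAB (Or.inr hB)
          (hS.stiff z t htz (Or.inr hB)).1), hsq (hdle ?_)⟩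
        have := hbs (hs ((hen z).2.1 t ⟨hgt.le, ht.2.le⟩ hB.le))
        linarith
  · intro z t ht hoff
    exact hasDerivAt_corrector_stiff hh0 ht (hasDerivAt_offDefectPart hAB hoff
      (hS.stiff z t ht hoff).1)

lemma lintegral_le_tsum_of_forall_cell {ε : ℝ} (hε : 0 < ε) {F : ℝ → ENNReal} {c : ℤ → ENNReal}
    (hF : ∀ (z : ℤ) (x : ℝ), x / ε ∈ Ico (z : ℝ) (z + 1) → F x ≤ c z) :
    ∫⁻ x, F x ≤ ENNReal.ofReal ε * ∑' z, c z := by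
  rw [← setLIntegral_univ, ← iUnion_Ico_zsmul hε, ← ENNReal.tsum_mul_left]
  refine (lintegral_iUnion_le _ _).trans (ENNReal.tsum_le_tsum fun z => ?_)
  calc ∫⁻ x in Ico (z • ε) ((z + 1) • ε), F x
      ≤ ∫⁻ _ in Ico (z • ε) ((z + 1) • ε), c z := by
        refine setLIntegral_mono' measurableSet_Ico fun x hx => hF z x ?_
        rw [zsmul_eq_mul, zsmul_eq_mul] at hx
        push_cast at hx
        exact ⟨(le_div_iff₀ hε).2 hx.1, (div_lt_iff₀ hε).2 hx.2⟩
    _ = ENNReal.ofReal ε * c z := by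
        rw [setLIntegral_const, Real.volume_Ico, mul_comm, zsmul_eq_mul, zsmul_eq_mul]
        congr 2
        push_cast
        ring

lemma tsum_cellMass {ε : ℝ} (hε : 0 < ε) {u : ℝ → ℂ} (hInt : Integrable fun x => ‖u x‖ ^ 2) :
    ENNReal.ofReal ε * ∑' z, ENNReal.ofReal (cellMass (fun t => u (ε * t)) z)
      = ENNReal.ofReal (∫ x, ‖u x‖ ^ 2) := by
  rw [ofReal_integral_eq_lintegral_ofReal hInt (Eventually.of_forall fun x => by positivity),
    ← setLIntegral_univ, ← iUnion_Ioc_zsmul hε,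
    lintegral_iUnion (fun _ => measurableSet_Ioc) (pairwise_disjoint_Ioc_zsmul ε),
    ← ENNReal.tsum_mul_left]
  refine tsum_congr fun z => ?_
  rw [← ofReal_integral_eq_lintegral_ofReal hInt.integrableOn
    (Eventually.of_forall fun x => by positivity), ← ENNReal.ofReal_mul hε.le, cellMass,
    intervalIntegral.integral_comp_mul_left (fun x => ‖u x‖ ^ 2) hε.ne', smul_eq_mul,
    mul_inv_cancel_left₀ hε.ne', intervalIntegral.integral_of_le (by nlinarith),
    zsmul_eq_mul, zsmul_eq_mul]
  push_cast
  rw [mul_comm ε, mul_comm ε]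

lemma lintegral_le_of_forall_cell {ε : ℝ} (hε : 0 < ε) {u : ℝ → ℂ}
    (hInt : Integrable fun x => ‖u x‖ ^ 2) (hu : ∫ x, ‖u x‖ ^ 2 = 1) {F : ℝ → ENNReal} {C : ℝ}
    (hC : 0 ≤ C) (hF : ∀ (z : ℤ) (x : ℝ), x / ε ∈ Ico (z : ℝ) (z + 1) →
      F x ≤ ENNReal.ofReal (C * (cellMass (fun t => u (ε * t)) (z - 1)
        + cellMass (fun t => u (ε * t)) z + cellMass (fun t => u (ε * t)) (z + 1)))) :
    ∫⁻ x, F x ≤ ENNReal.ofReal (3 * C) := by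
  refine (lintegral_le_tsum_of_forall_cell hε hF).trans (le_of_eq ?_)
  have hm := tsum_cellMass hε hInt
  rw [hu, ENNReal.ofReal_one] at hm
  set g := cellMass fun t => u (ε * t) with hg
  have h0 : ∀ z, 0 ≤ g z := cellMass_nonneg _
  have h1 : ∀ z, ENNReal.ofReal (C * (g (z - 1) + g z + g (z + 1))) = ENNReal.ofReal C *
      (ENNReal.ofReal (g (z - 1)) + ENNReal.ofReal (g z) + ENNReal.ofReal (g (z + 1))) := by
    intro z
    rw [ENNReal.ofReal_mul hC, ENNReal.ofReal_add (add_nonneg (h0 _) (h0 _)) (h0 _),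
      ENNReal.ofReal_add (h0 _) (h0 _)]
  have h2 : ∑' z, ENNReal.ofReal (g (z - 1)) = ∑' z, ENNReal.ofReal (g z) :=
    (Equiv.subRight (1 : ℤ)).tsum_eq fun z => ENNReal.ofReal (g z)
  have h3 : ∑' z, ENNReal.ofReal (g (z + 1)) = ∑' z, ENNReal.ofReal (g z) :=
    (Equiv.addRight (1 : ℤ)).tsum_eq fun z => ENNReal.ofReal (g z)
  simp_rw [h1]
  rw [ENNReal.tsum_mul_left, ENNReal.tsum_add, ENNReal.tsum_add, h2, h3, mul_left_comm]
  have h4 : ENNReal.ofReal ε * (∑' z, ENNReal.ofReal (g z) + ∑' z, ENNReal.ofReal (g z)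
      + ∑' z, ENNReal.ofReal (g z)) = 3 := by
    rw [mul_add, mul_add, hm]
    norm_num
  rw [h4, mul_comm 3 C, ENNReal.ofReal_mul hC]
  norm_num

lemma coe_nnnorm_sq (z : ℂ) : (‖z‖₊ : ENNReal) ^ 2 = ENNReal.ofReal (‖z‖ ^ 2) := by
  rw [ENNReal.ofReal_pow (norm_nonneg z), ofReal_norm, enorm_eq_nnnorm]

open Classical in
/-- Exponential localisation of solutions to the defect under a hyperbolic recurrence. -/
lemma exists_setLIntegral_deep_le {β M h : ℝ} (hβ : 0 < β) (hM : 0 ≤ M) (hh0 : 0 < h)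
    (hh1 : h < 1) :
    ∃ C > 0, ∀ (η A B : ℝ) (b₀ c₀ b₁ c₁ : ℝ → ℝ) (ε τ : ℝ) (u s : ℝ → ℂ), 0 < ε →
      CoefBounds β M η b₀ c₀ b₁ c₁ →
      IsCellSolution h A B b₀ c₀ b₁ c₁ (fun t => u (ε * t)) s →
      (Integrable fun x => ‖u x‖ ^ 2) → ∫ x, ‖u x‖ ^ 2 = 1 → 2 < τ →
      (∀ z : ℤ, OffDefect A B (z - 1) → OffDefect A B z →
        τ * ‖nodal (fun t => u (ε * t)) s z‖
          ≤ ‖nodal (fun t => u (ε * t)) s (z + 1)‖ + ‖nodal (fun t => u (ε * t)) s (z - 1)‖) →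
      ∀ (J : ℕ) (T : Set ℝ), MeasurableSet T →
        (∀ (z : ℤ), ∀ x ∈ T, x / ε ∈ Ico (z : ℝ) (z + 1) → DeepOffDefect A B J z) →
        ∫⁻ x in T, (‖u x‖₊ : ENNReal) ^ 2 ≤ ENNReal.ofReal C * ENNReal.ofReal (4 / τ ^ 2) ^ J := by
  obtain ⟨K, hK, hen⟩ := exists_energy_le_cellMass hβ hM hh0 hh1
  refine ⟨Real.exp (2 * M) ^ 2 * 2 * K, by positivity, ?_⟩
  intro η A B b₀ c₀ b₁ c₁ ε τ u s hε hc hS hInt hu hτ hrec J T hT hdeep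
  have hen := hen η A B b₀ c₀ b₁ c₁ _ s hc hS
  set U : ℝ → ℂ := fun t => u (ε * t) with hU
  set P : ℝ := Real.exp (2 * M) ^ 2 * 2 with hP
  have hP0 : 0 ≤ P := by positivity
  have hcell : ∀ (z : ℤ) (x : ℝ), x / ε ∈ Ico (z : ℝ) (z + 1) →
      T.indicator (fun x => (‖u x‖₊ : ENNReal) ^ 2) x ≤ ENNReal.ofReal P *
        (if DeepOffDefect A B J z then ENNReal.ofReal (‖nodal U s z‖ ^ 2) else 0) := by
    intro z x hx
    by_cases hxT : x ∈ T
    · have hz := hdeep z x hxT hx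
      rw [indicator_of_mem hxT, if_pos hz, coe_nnnorm_sq, ← ENNReal.ofReal_mul hP0]
      apply ENNReal.ofReal_le_ofReal
      have h1 := hS.energy_cell_le hc hh0 hh1 (hz z (by simp)) (x := z) (y := x / ε)
        ⟨le_rfl, by linarith⟩ ⟨hx.1, hx.2.le⟩
      have hUx : U (x / ε) = u x := congrArg u (mul_div_cancel₀ x hε.ne')
      rw [hUx] at h1
      have h2 : ‖U z‖ ^ 2 ≤ ‖nodal U s z‖ ^ 2 :=
        pow_le_pow_left₀ (norm_nonneg _) (norm_fst_le (nodal U s z)) 2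
      have h3 : ‖s z‖ ^ 2 ≤ ‖nodal U s z‖ ^ 2 :=
        pow_le_pow_left₀ (norm_nonneg _) (norm_snd_le (nodal U s z)) 2
      calc ‖u x‖ ^ 2 ≤ Real.exp (2 * M) ^ 2 * (‖U z‖ ^ 2 + ‖s z‖ ^ 2) := by
            nlinarith [sq_nonneg ‖s (x / ε)‖]
        _ ≤ Real.exp (2 * M) ^ 2 * (‖nodal U s z‖ ^ 2 + ‖nodal U s z‖ ^ 2) := by gcongr
        _ = _ := by ring
    · rw [indicator_of_notMem hxT]
      exact zero_le
  have hoff : ∑' z : ℤ, (if OffDefect A B z then ENNReal.ofReal (‖nodal U s z‖ ^ 2) else 0)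
      ≤ ENNReal.ofReal K * ∑' z : ℤ, ENNReal.ofReal (cellMass U z) := by
    rw [← ENNReal.tsum_mul_left]
    refine ENNReal.tsum_le_tsum fun z => ?_
    split_ifs with hz
    · rw [← ENNReal.ofReal_mul hK.le]
      apply ENNReal.ofReal_le_ofReal
      refine le_trans ?_ ((hen z).1 (hz.imp (fun h => by linarith) id) z ⟨le_rfl, by linarith⟩)
      rcases max_choice ‖U z‖ ‖s z‖ with hm | hm
      · rw [nodal, Prod.norm_mk, hm]
        nlinarith [sq_nonneg ‖s z‖]
      · rw [nodal, Prod.norm_mk, hm]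
        nlinarith [sq_nonneg ‖U z‖]
    · exact zero_le
  have hm := tsum_cellMass hε hInt
  rw [hu, ENNReal.ofReal_one] at hm
  rw [← lintegral_indicator hT]
  calc _ ≤ ENNReal.ofReal ε * ∑' z : ℤ, ENNReal.ofReal P *
        (if DeepOffDefect A B J z then ENNReal.ofReal (‖nodal U s z‖ ^ 2) else 0) :=
        lintegral_le_tsum_of_forall_cell hε hcell
    _ ≤ ENNReal.ofReal ε * (ENNReal.ofReal P * (ENNReal.ofReal (4 / τ ^ 2) ^ J *
        (ENNReal.ofReal K * ∑' z : ℤ, ENNReal.ofReal (cellMass U z)))) := by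
        rw [ENNReal.tsum_mul_left]
        gcongr
        exact (tsum_deep_le hτ hrec J).trans (by gcongr)
    _ = ENNReal.ofReal P * ENNReal.ofReal K * ENNReal.ofReal (4 / τ ^ 2) ^ J *
        (ENNReal.ofReal ε * ∑' z : ℤ, ENNReal.ofReal (cellMass U z)) := by ring
    _ = _ := by rw [hm, mul_one, ← ENNReal.ofReal_mul hP0]

lemma deepOffDefect_of_le_distDefect {dm dp ε x : ℝ} (hε : 0 < ε) {J : ℕ}
    (hx : (J + 1) * ε ≤ distDefect dm dp x) {z : ℤ} (hz : x / ε ∈ Ico (z : ℝ) (z + 1)) :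
    DeepOffDefect (dm / ε) (dp / ε) J z := by
  intro i hi
  have hJε : 0 < (J + 1) * ε := by positivity
  have h1 : x - ε < ε * z := by
    have := (div_lt_iff₀ hε).1 hz.2
    linarith
  have h2 : ε * z ≤ x := by
    have := (le_div_iff₀ hε).1 hz.1
    linarith
  rw [abs_le] at hi
  have hi1 : (i : ℝ) ≤ z + J := by
    exact_mod_cast (by omega : i ≤ z + J)
  have hi2 : (z : ℝ) - J ≤ i := by
    exact_mod_cast (by omega : z - J ≤ i)
  rcases le_max_iff.1 hx with hx | hx
  · rcases le_max_iff.1 hx with hx | hx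
    · left
      rw [le_div_iff₀ hε]
      nlinarith
    · right
      rw [div_le_iff₀ hε]
      nlinarith
  · linarith

lemma isClosed_le_distDefect (dm dp r : ℝ) : IsClosed {x : ℝ | r ≤ distDefect dm dp x} := by
  unfold distDefect
  exact isClosed_le (by fun_prop) (by fun_prop)

lemma countable_interfaceSet (h dm dp ε : ℝ) : (interfaceSet h dm dp ε).Countable := by
  have hr : ∀ f : ℤ → ℝ, {x | ∃ z : ℤ, x = f z}.Countable := fun f =>
    (countable_range f).mono (by
      rintro x ⟨z, rfl⟩
      exact mem_range_self z)
  exact (((countable_singleton dp).insert dm).union (hr _)).union (hr _)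

lemma mul_notMem_interfaceSet {h dm dp ε t : ℝ} (hh0 : 0 < h) (hh1 : h < 1) (hε : 0 < ε) {z : ℤ}
    (ht : t ∈ Ioo (z : ℝ) (z + 1)) (hth : t ≠ z + h) (hoff : t < dm / ε ∨ dp / ε < t)
    (hd : dm < dp) : ε * t ∉ interfaceSet h dm dp ε := by
  rintro ((hx | ⟨i, hi⟩) | ⟨i, hi⟩)
  · rw [lt_div_iff₀ hε, div_lt_iff₀ hε] at hoff
    rcases hx with hx | hx <;> rcases hoff with ho | ho <;>
      linarith [mem_singleton_iff.1 hx]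
  · have hi := mul_left_cancel₀ hε.ne' hi
    rw [hi] at ht
    have h1 : z < i := by exact_mod_cast ht.1
    have h2 : i < z + 1 := by exact_mod_cast ht.2
    omega
  · have hi := mul_left_cancel₀ hε.ne' hi
    rw [hi] at ht hth
    have h1 : z < i + 1 := by
      have : (z : ℝ) < i + 1 := by linarith [ht.1]
      exact_mod_cast this
    have h2 : i < z + 1 := by
      have : (i : ℝ) < z + 1 := by linarith [ht.2]
      exact_mod_cast this
    exact hth (by rw [show i = z by omega])

lemma mem_Ioo_floor_of_notMem_interfaceSet {h dm dp ε x : ℝ} (hε : 0 < ε)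
    (hx : x ∉ interfaceSet h dm dp ε) :
    x / ε ∈ Ioo (⌊x / ε⌋ : ℝ) (⌊x / ε⌋ + 1) ∧ x / ε ≠ ⌊x / ε⌋ + h ∧ x / ε ≠ dm / ε ∧
      x / ε ≠ dp / ε := by
  have hx' : x = ε * (x / ε) := (mul_div_cancel₀ x hε.ne').symm
  refine ⟨⟨lt_of_le_of_ne (Int.floor_le _) fun hz => hx ?_, Int.lt_floor_add_one _⟩,
    fun hz => hx ?_, fun hz => hx ?_, fun hz => hx ?_⟩
  · exact Or.inl (Or.inr ⟨⌊x / ε⌋, by rw [hz, ← hx']⟩)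
  · exact Or.inr ⟨⌊x / ε⌋, by rw [← hz, ← hx']⟩
  · exact Or.inl (Or.inl (Or.inl ((div_left_inj' hε.ne').1 hz)))
  · exact Or.inl (Or.inl (Or.inr ((div_left_inj' hε.ne').1 hz)))

lemma mul_mem_softComponent_iff {h ε t : ℝ} (hε : 0 < ε) :
    ε * t ∈ softComponent h ε ↔ ∃ z : ℤ, t ∈ Ioo (z : ℝ) (z + h) := by
  refine exists_congr fun z => ?_
  rw [mul_lt_mul_iff_right₀ hε, ← mul_add, mul_lt_mul_iff_right₀ hε]
  rfl

/-- A defect eigenfunction in the variable `t = x / ε`. -/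
lemma IsDefectEigenpair.exists_isCellSolution {h dm dp : ℝ} {a₀ ρ₀ a₁ ρ₁ aD ρD : ℝ → ℝ}
    {ε lam : ℝ} {u : ℝ → ℂ} (hh0 : 0 < h) (hh1 : h < 1) (hd : dm < dp) (hε : 0 < ε)
    (hu : IsDefectEigenpair h dm dp a₀ ρ₀ a₁ ρ₁ aD ρD ε lam u) :
    ∃ s : ℝ → ℂ, IsCellSolution h (dm / ε) (dp / ε) (fun t => (a₀ t)⁻¹) (fun t => lam * ρ₀ t)
      (fun t => ε ^ 2 * (a₁ t)⁻¹) (fun t => lam * ρ₁ t) (fun t => u (ε * t)) s := by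
  obtain ⟨-, huc, -, σ, hσc, hσ⟩ := hu
  have hε' : (ε : ℂ) ≠ 0 := by exact_mod_cast hε.ne'
  have hmul : ∀ t : ℝ, HasDerivAt (fun t : ℝ => ε * t) ε t := fun t => by
    simpa using (hasDerivAt_id t).const_mul ε
  have hnD : ∀ {t : ℝ}, t < dm / ε ∨ dp / ε < t → ε * t ∉ Ioo dm dp := by
    intro t hoff hx
    rw [lt_div_iff₀ hε, div_lt_iff₀ hε] at hoff
    rcases hoff with ho | ho
    · linarith [hx.1]
    · linarith [hx.2]
  have key : ∀ t : ℝ, ε * t ∉ interfaceSet h dm dp ε →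
      HasDerivAt (fun t => u (ε * t))
        ((ε : ℂ) * (σ (ε * t) / (defectCoef h dm dp a₀ a₁ aD ε (ε * t) : ℂ))) t ∧
      HasDerivAt (fun t => σ (ε * t) / ε)
        (-((lam : ℂ) * (defectDens h dm dp ρ₀ ρ₁ ρD ε (ε * t) : ℂ) * u (ε * t))) t := by
    intro t ht
    obtain ⟨h1, h2⟩ := hσ _ ht
    refine ⟨?_, ?_⟩
    · have := HasDerivAt.scomp t h1 (hmul t)
      rw [Complex.real_smul] at this
      exact this
    · have := (HasDerivAt.scomp t h2 (hmul t)).div_const (ε : ℂ)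
      rw [Complex.real_smul, mul_div_cancel_left₀ _ hε'] at this
      exact this
  refine ⟨fun t => σ (ε * t) / ε, by fun_prop, by fun_prop, ?_, ?_⟩
  · intro z t ht hoff
    have hS := mul_notMem_interfaceSet hh0 hh1 hε (z := z) (t := t)
      ⟨ht.1, by linarith [ht.2]⟩ ht.2.ne hoff hd
    have hsoft := (mul_mem_softComponent_iff hε).2 ⟨z, ht⟩
    obtain ⟨h1, h2⟩ := key t hS
    rw [defectCoef, if_neg (hnD hoff), if_pos hsoft, mul_div_cancel_left₀ _ hε.ne'] at h1
    rw [defectDens, if_neg (hnD hoff), if_pos hsoft, mul_div_cancel_left₀ _ hε.ne'] at h2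
    refine ⟨h1.congr_deriv ?_, h2.congr_deriv ?_⟩
    · push_cast
      rw [div_eq_mul_inv, mul_inv, div_eq_mul_inv]
      field_simp
    · push_cast
      rfl
  · intro z t ht hoff
    have hS := mul_notMem_interfaceSet hh0 hh1 hε (z := z) (t := t)
      ⟨by linarith [ht.1], ht.2⟩ ht.1.ne' hoff hd
    have hsoft : ε * t ∉ softComponent h ε := by
      rw [mul_mem_softComponent_iff hε]
      rintro ⟨i, hi⟩
      have h1 : z < i := by
        have : (z : ℝ) < i := by linarith [ht.1, hi.2]
        exact_mod_cast this
      have h2 : i < z + 1 := by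
        have : (i : ℝ) < z + 1 := by linarith [ht.2, hi.1]
        exact_mod_cast this
      omega
    obtain ⟨h1, h2⟩ := key t hS
    rw [defectCoef, if_neg (hnD hoff), if_neg hsoft, mul_div_cancel_left₀ _ hε.ne'] at h1
    rw [defectDens, if_neg (hnD hoff), if_neg hsoft, mul_div_cancel_left₀ _ hε.ne'] at h2
    refine ⟨h1.congr_deriv ?_, h2.congr_deriv ?_⟩
    · push_cast
      rw [div_eq_mul_inv, div_eq_mul_inv]
      field_simp
    · push_cast
      rfl

lemma Function.Periodic.exists_pos_bounds {f : ℝ → ℝ} (hf : Function.Periodic f 1)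
    (hc : Continuous f) (hp : ∀ x, 0 < f x) : ∃ m > 0, ∃ M > 0, ∀ x, m ≤ f x ∧ f x ≤ M := by
  have hne : (Icc (0:ℝ) 1).Nonempty := ⟨0, by simp⟩
  obtain ⟨x, -, hx⟩ := isCompact_Icc.exists_isMinOn hne hc.continuousOn
  obtain ⟨y, -, hy⟩ := isCompact_Icc.exists_isMaxOn hne hc.continuousOn
  refine ⟨f x, hp x, f y, hp y, fun t => ?_⟩
  obtain ⟨r, hr, htr⟩ := hf.exists_mem_Ico₀ one_pos t
  rw [htr]
  exact ⟨hx ⟨hr.1, hr.2.le⟩, hy ⟨hr.1, hr.2.le⟩⟩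

/-- The rescaled coefficients are bounded uniformly in bounded `ε` and `λ`. -/
lemma exists_coefBounds {a₀ ρ₀ a₁ ρ₁ : ℝ → ℝ}
    (ha₀c : Continuous a₀) (ha₀p : ∀ x, 0 < a₀ x) (ha₀per : Function.Periodic a₀ 1)
    (hρ₀c : Continuous ρ₀) (hρ₀p : ∀ x, 0 < ρ₀ x) (hρ₀per : Function.Periodic ρ₀ 1)
    (ha₁c : Continuous a₁) (ha₁p : ∀ x, 0 < a₁ x) (ha₁per : Function.Periodic a₁ 1)
    (hρ₁c : Continuous ρ₁) (hρ₁p : ∀ x, 0 < ρ₁ x) (hρ₁per : Function.Periodic ρ₁ 1)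
    {E Λ : ℝ} (hΛ : 0 ≤ Λ) :
    ∃ β > 0, ∃ M ≥ 0, ∀ ε lam : ℝ, 0 < ε → ε ≤ E → |lam| ≤ Λ →
      CoefBounds β M (ε ^ 2) (fun t => (a₀ t)⁻¹) (fun t => lam * ρ₀ t)
        (fun t => ε ^ 2 * (a₁ t)⁻¹) (fun t => lam * ρ₁ t) := by
  obtain ⟨m₀, hm₀, M₀, hM₀, hb₀⟩ := ha₀per.exists_pos_bounds ha₀c ha₀p
  obtain ⟨m₁, hm₁, M₁, hM₁, hb₁⟩ := ha₁per.exists_pos_bounds ha₁c ha₁p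
  obtain ⟨_, _, R₀, hR₀, hr₀⟩ := hρ₀per.exists_pos_bounds hρ₀c hρ₀p
  obtain ⟨_, _, R₁, hR₁, hr₁⟩ := hρ₁per.exists_pos_bounds hρ₁c hρ₁p
  have p₀ : 0 < m₀⁻¹ := inv_pos.2 hm₀
  have p₁ : 0 < m₁⁻¹ := inv_pos.2 hm₁
  have p₂ : 0 ≤ E ^ 2 * m₁⁻¹ := by positivity
  have p₃ : 0 ≤ Λ * R₀ := by positivity
  have p₄ : 0 ≤ Λ * R₁ := by positivity
  have habs : ∀ {lam r R : ℝ}, |lam| ≤ Λ → 0 < r → r ≤ R → |lam * r| ≤ Λ * R := by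
    intro lam r R h1 h2 h3
    rw [abs_mul, abs_of_pos h2]
    exact mul_le_mul h1 h3 h2.le hΛ
  refine ⟨M₀⁻¹, inv_pos.2 hM₀, m₀⁻¹ + m₁⁻¹ + E ^ 2 * m₁⁻¹ + Λ * R₀ + Λ * R₁, by positivity, ?_⟩
  intro ε lam hε hεE hlam
  have hinv : ∀ t, (a₁ t)⁻¹ ≤ m₁⁻¹ := fun t => inv_anti₀ hm₁ (hb₁ t).1
  have hε2 : ε ^ 2 ≤ E ^ 2 := pow_le_pow_left₀ hε.le hεE 2
  have habs₁ : ∀ t, |ε ^ 2 * (a₁ t)⁻¹| ≤ ε ^ 2 * m₁⁻¹ := by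
    intro t
    rw [abs_of_pos (mul_pos (by positivity) (inv_pos.2 (ha₁p t)))]
    exact mul_le_mul_of_nonneg_left (hinv t) (by positivity)
  refine ⟨ha₀c.inv₀ fun t => (ha₀p t).ne', by fun_prop,
    continuous_const.mul (ha₁c.inv₀ fun t => (ha₁p t).ne'), by fun_prop,
    fun t => inv_anti₀ (ha₀p t) (hb₀ t).2, fun t => ?_, fun t => ?_, fun t => ?_, fun t => ?_,
    fun t => ?_⟩
  · rw [abs_of_pos (inv_pos.2 (ha₀p t))]
    linarith [inv_anti₀ hm₀ (hb₀ t).1]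
  · linarith [habs hlam (hρ₀p t) (hr₀ t).2]
  · linarith [habs₁ t, mul_le_mul_of_nonneg_right hε2 p₁.le]
  · linarith [habs hlam (hρ₁p t) (hr₁ t).2]
  · refine (habs₁ t).trans (mul_le_mul_of_nonneg_left ?_ (by positivity))
    linarith

/-- If the part of the mass lying `J + 1` cells away from the defect decays geometrically in
`J`, then the mass at distance `ε ^ α` tends to zero. -/
lemma tendsto_setLIntegral_distDefect {dm dp C τ : ℝ} (hτ : 2 < τ) {ε : ℕ → ℝ}
    (hεpos : ∀ k, 0 < ε k) (hε : Tendsto ε atTop (𝓝 0)) {F : ℕ → ℝ → ENNReal}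
    (hF : ∀ᶠ k in atTop, ∀ (J : ℕ) (T : Set ℝ), MeasurableSet T →
      (∀ (z : ℤ), ∀ x ∈ T, x / ε k ∈ Ico (z : ℝ) (z + 1) →
        DeepOffDefect (dm / ε k) (dp / ε k) J z) →
      ∫⁻ x in T, F k x ≤ ENNReal.ofReal C * ENNReal.ofReal (4 / τ ^ 2) ^ J)
    {α : ℝ} (hα : α < 1) :
    Tendsto (fun k => ∫⁻ x in {x : ℝ | ε k ^ α ≤ distDefect dm dp x}, F k x) atTop (𝓝 0) := by
  have hq : ENNReal.ofReal (4 / τ ^ 2) < 1 := by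
    rw [ENNReal.ofReal_lt_one, div_lt_one (by positivity)]
    nlinarith
  have hpow : Tendsto (fun J : ℕ => ENNReal.ofReal C * ENNReal.ofReal (4 / τ ^ 2) ^ J) atTop
      (𝓝 0) := by
    have := ENNReal.Tendsto.const_mul (a := ENNReal.ofReal C)
      (ENNReal.tendsto_pow_atTop_nhds_zero_of_lt_one hq) (Or.inr ENNReal.ofReal_ne_top)
    rwa [mul_zero] at this
  rw [ENNReal.tendsto_nhds_zero]
  intro e he
  obtain ⟨J, hJ⟩ := (ENNReal.tendsto_nhds_zero.1 hpow e he).exists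
  have hrpow : Tendsto (fun k => (J + 1) * ε k ^ (1 - α)) atTop (𝓝 0) := by
    have := (hε.rpow_const (Or.inr (sub_pos.2 hα).le) (p := 1 - α)).const_mul ((J : ℝ) + 1)
    rwa [Real.zero_rpow (sub_pos.2 hα).ne', mul_zero] at this
  filter_upwards [hF, hrpow.eventually_lt_const one_pos] with k hk hkJ
  refine (hk J _ (isClosed_le_distDefect dm dp _).measurableSet fun z x hx hz =>
    deepOffDefect_of_le_distDefect (hεpos k) (le_trans ?_ hx) hz).trans hJ
  have hα0 : 0 < ε k ^ α := Real.rpow_pos_of_pos (hεpos k) α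
  calc (J + 1) * ε k = (J + 1) * ε k ^ (1 - α) * ε k ^ α := by
        rw [mul_assoc, ← Real.rpow_add (hεpos k), sub_add_cancel, Real.rpow_one]
    _ ≤ ε k ^ α := by nlinarith

/-- Decomposition `u_k = v_k + w_k` of defect eigenfunctions whose
eigenvalues converge to a point `λ₀` in a gap of the limit spectrum: `v_k` is flat on the
stiff component outside the defect, `w_k` is of order `ε_k²` in `L²` with derivative of
order `ε_k`, and `v_k` localises to the defect. -/
theorem eigenfunction_decomposition_localisation
    (h : ℝ) (hh0 : 0 < h) (hh1 : h < 1)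
    (dm dp : ℝ) (hd : dm < dp)
    (a₀ ρ₀ a₁ ρ₁ : ℝ → ℝ)
    (ha₀c : Continuous a₀) (ha₀p : ∀ x, 0 < a₀ x) (ha₀per : Function.Periodic a₀ 1)
    (hρ₀c : Continuous ρ₀) (hρ₀p : ∀ x, 0 < ρ₀ x) (hρ₀per : Function.Periodic ρ₀ 1)
    (ha₁c : Continuous a₁) (ha₁p : ∀ x, 0 < a₁ x) (ha₁per : Function.Periodic a₁ 1)
    (hρ₁c : Continuous ρ₁) (hρ₁p : ∀ x, 0 < ρ₁ x) (hρ₁per : Function.Periodic ρ₁ 1)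
    (aD ρD : ℝ → ℝ)
    (haDc : Continuous aD) (haDp : ∀ x, 0 < aD x)
    (hρDc : Continuous ρD) (hρDp : ∀ x, 0 < ρD x)
    -- the fundamental system at `λ₀` on `[0,h]`
    (lam₀ : ℝ) (v₁ p₁ v₂ p₂ : ℝ → ℝ)
    (hv₁ : ∀ y ∈ Icc (0:ℝ) h, HasDerivAt v₁ (p₁ y / a₀ y) y)
    (hp₁ : ∀ y ∈ Icc (0:ℝ) h, HasDerivAt p₁ (-(lam₀ * ρ₀ y * v₁ y)) y)
    (hv₂ : ∀ y ∈ Icc (0:ℝ) h, HasDerivAt v₂ (p₂ y / a₀ y) y)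
    (hp₂ : ∀ y ∈ Icc (0:ℝ) h, HasDerivAt p₂ (-(lam₀ * ρ₀ y * v₂ y)) y)
    (hv₁0 : v₁ 0 = 1) (hp₁0 : p₁ 0 = 0) (hv₂0 : v₂ 0 = 0) (hp₂0 : p₂ 0 = 1)
    -- `λ₀` lies in a gap of the limit spectrum: `|F(λ₀)| > 2`
    (hgap : 2 < |v₁ h + p₂ h - lam₀ * v₂ h * ∫ y in h..(1:ℝ), ρ₁ y|)
    -- the sequence of defect eigenpairs
    (ε : ℕ → ℝ) (hεpos : ∀ k, 0 < ε k) (hε : Tendsto ε atTop (nhds 0))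
    (lam : ℕ → ℝ) (u : ℕ → ℝ → ℂ)
    (heig : ∀ k, IsDefectEigenpair h dm dp a₀ ρ₀ a₁ ρ₁ aD ρD (ε k) (lam k) (u k))
    (hnorm : ∀ k, ∫ x, ‖u k x‖ ^ 2 = 1)
    (hlam : Tendsto lam atTop (nhds lam₀)) :
    ∃ C > 0, ∃ v w : ℕ → ℝ → ℂ,
      (∀ k, Continuous (v k) ∧ Continuous (w k)) ∧
      (∀ k x, u k x = v k x + w k x) ∧
      -- (i) differentiability off the interface set, and `v_k′ = 0` on `Ω₁^{ε_k} ∖ (D ∪ S)`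
      (∀ k, ∀ x ∉ interfaceSet h dm dp (ε k),
        DifferentiableAt ℝ (v k) x ∧ DifferentiableAt ℝ (w k) x) ∧
      (∀ k, ∀ x ∈ stiffComponent h (ε k),
        x ∉ Ioo dm dp → x ∉ interfaceSet h dm dp (ε k) → deriv (v k) x = 0) ∧
      -- (ii) smallness of `w_k`
      (∀ k, (∫⁻ x, (‖w k x‖₊ : ENNReal) ^ 2) ≤ ENNReal.ofReal (C * ε k ^ 4)) ∧
      (∀ k, (∫⁻ x in (interfaceSet h dm dp (ε k))ᶜ, (‖deriv (w k) x‖₊ : ENNReal) ^ 2)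
        ≤ ENNReal.ofReal (C * ε k ^ 2)) ∧
      -- (iii) localisation of `v_k`
      (∀ α ∈ Ioo (0:ℝ) 1,
        Tendsto
          (fun k => ∫⁻ x in {x : ℝ | ε k ^ α ≤ distDefect dm dp x},
            (‖v k x‖₊ : ENNReal) ^ 2)
          atTop (nhds 0)) := by
  obtain ⟨E, hE⟩ := (Metric.isBounded_range_of_tendsto ε hε).exists_norm_le
  obtain ⟨Λ, hΛ⟩ := (Metric.isBounded_range_of_tendsto lam hlam).exists_norm_le
  have hεE : ∀ k, ε k ≤ E := fun k => (le_abs_self _).trans (hE _ (mem_range_self k))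
  have hlamΛ : ∀ k, |lam k| ≤ Λ := fun k => hΛ _ (mem_range_self k)
  have hlam₀Λ : |lam₀| ≤ Λ := le_of_tendsto hlam.abs (Eventually.of_forall hlamΛ)
  obtain ⟨β, hβ, M, hM, hcoef⟩ := exists_coefBounds ha₀c ha₀p ha₀per hρ₀c hρ₀p hρ₀per ha₁c ha₁p
    ha₁per hρ₁c hρ₁p hρ₁per (E := E) ((abs_nonneg _).trans hlam₀Λ)
  have hc := fun k => hcoef (ε k) (lam k) (hεpos k) (hεE k) (hlamΛ k)
  have hc₀ := hcoef (ε 0) lam₀ (hεpos 0) (hεE 0) hlam₀Λ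
  have hL : LimitSystem h M (fun t => (a₀ t)⁻¹) (fun t => lam₀ * ρ₀ t) (fun t => lam₀ * ρ₁ t)
      v₁ p₁ v₂ p₂ :=
    { cont_c₀ := hc₀.cont_c₀
      cont_c₁ := hc₀.cont_c₁
      abs_c₁ := hc₀.abs_c₁
      per_b₀ := fun t => by simp only [ha₀per t]
      per_c₀ := fun t => by simp only [hρ₀per t]
      per_c₁ := fun t => by simp only [hρ₁per t]
      deriv_v₁ := fun y hy => (hv₁ y hy).congr_deriv (div_eq_inv_mul _ _)
      deriv_p₁ := hp₁
      deriv_v₂ := fun y hy => (hv₂ y hy).congr_deriv (div_eq_inv_mul _ _)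
      deriv_p₂ := hp₂
      v₁_zero := hv₁0
      p₁_zero := hp₁0
      v₂_zero := hv₂0
      p₂_zero := hp₂0 }
  choose s hs using fun k => (heig k).exists_isCellSolution hh0 hh1 hd (hεpos k)
  have hInt : ∀ k, Integrable fun x => ‖u k x‖ ^ 2 := fun k => (heig k).2.2.1
  have hAB : ∀ k, dm / ε k < dp / ε k := fun k => div_lt_div_of_pos_right hd (hεpos k)
  obtain ⟨C, hC, hcor⟩ := exists_corrector_bounds hβ hM hh0 hh1
  choose ω hωc hω hω' hωs using fun k => hcor (ε k ^ 2) _ _ _ _ _ _ _ (s k) (sq_nonneg _) (hAB k)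
    (hc k) (hs k)
  set w : ℕ → ℝ → ℂ := fun k x => ω k (x / ε k) with hw
  have hwd : ∀ k x d, HasDerivAt (ω k) d (x / ε k) →
      HasDerivAt (w k) (((ε k)⁻¹ : ℝ) * d) x := by
    intro k x d hd
    have hdiv : HasDerivAt (fun x : ℝ => x / ε k) (ε k)⁻¹ x := by
      simpa using (hasDerivAt_id x).div_const (ε k)
    have := HasDerivAt.scomp x hd hdiv
    rwa [Complex.real_smul] at this
  have hud : ∀ k, ∀ x ∉ interfaceSet h dm dp (ε k), DifferentiableAt ℝ (u k) x := by
    intro k x hx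
    obtain ⟨-, -, -, σ, -, hσ⟩ := heig k
    exact (hσ x hx).1.differentiableAt
  have hwd' : ∀ k, ∀ x ∉ interfaceSet h dm dp (ε k), DifferentiableAt ℝ (w k) x := by
    intro k x hx
    obtain ⟨h1, h2, h3, h4⟩ := mem_Ioo_floor_of_notMem_interfaceSet (hεpos k) hx
    obtain ⟨d, hd, -⟩ := hω' k _ _ h1 h2 h3 h4
    exact (hwd k x d hd).differentiableAt
  have hwL : ∀ k, (∫⁻ x, (‖w k x‖₊ : ENNReal) ^ 2) ≤ ENNReal.ofReal (3 * C * ε k ^ 4) := by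
    intro k
    have := lintegral_le_of_forall_cell (hεpos k) (hInt k) (hnorm k)
      (F := fun x => (‖w k x‖₊ : ENNReal) ^ 2) (C := C * (ε k ^ 2) ^ 2) (by positivity)
      fun z x hx => by
        rw [coe_nnnorm_sq]
        exact ENNReal.ofReal_le_ofReal (hω k z _ hx)
    rwa [← pow_mul, ← mul_assoc] at this
  have hwcont : ∀ k, Continuous (w k) := fun k => (hωc k).comp (continuous_id.div_const _)
  refine ⟨3 * C, by positivity, fun k x => u k x - w k x, w,
    fun k => ⟨(heig k).2.1.sub (hwcont k), hwcont k⟩, fun k x => (sub_add_cancel _ _).symm,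
    fun k x hx => ⟨(hud k x hx).sub (hwd' k x hx), hwd' k x hx⟩, ?_, hwL, ?_, ?_⟩
  · rintro k x ⟨z, hz1, hz2⟩ hxD hxS
    have hε0 := hεpos k
    have ht : x / ε k ∈ Ioo ((z : ℝ) + h) (z + 1) :=
      ⟨by rw [lt_div_iff₀ hε0]; linarith, by rw [div_lt_iff₀ hε0]; linarith⟩
    obtain ⟨-, -, h3, h4⟩ := mem_Ioo_floor_of_notMem_interfaceSet hε0 hxS
    have hoff : x / ε k < dm / ε k ∨ dp / ε k < x / ε k := by
      rcases lt_or_gt_of_ne h3 with h3 | h3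
      · exact Or.inl h3
      rcases lt_or_gt_of_ne h4 with h4 | h4
      · exact absurd ⟨(div_lt_div_iff_of_pos_right hε0).1 h3,
          (div_lt_div_iff_of_pos_right hε0).1 h4⟩ hxD
      · exact Or.inr h4
    have hcomp : HasDerivAt (fun x => u k (ε k * (x / ε k)))
        (((ε k)⁻¹ : ℝ) * (((ε k ^ 2 * (a₁ (x / ε k))⁻¹ : ℝ) : ℂ) * s k (x / ε k))) x := by
      have hdiv : HasDerivAt (fun x : ℝ => x / ε k) (ε k)⁻¹ x := by
        simpa using (hasDerivAt_id x).div_const (ε k)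
      have := HasDerivAt.scomp x ((hs k).stiff z _ ht hoff).1 hdiv
      rwa [Complex.real_smul] at this
    simp_rw [mul_div_cancel₀ _ hε0.ne'] at hcomp
    have := (hcomp.sub (hwd k x _ (hωs k z _ ht hoff))).deriv
    rw [sub_self] at this
    exact this
  · intro k
    have hε0 := hεpos k
    rw [← lintegral_indicator (countable_interfaceSet h dm dp (ε k)).measurableSet.compl]
    have := lintegral_le_of_forall_cell hε0 (hInt k) (hnorm k)
      (F := (interfaceSet h dm dp (ε k))ᶜ.indicator fun x => (‖deriv (w k) x‖₊ : ENNReal) ^ 2)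
      (C := C * ε k ^ 2) (by positivity) fun z x hx => by
        by_cases hxS : x ∈ interfaceSet h dm dp (ε k)
        · rw [indicator_of_notMem (by simpa using hxS)]
          exact zero_le
        · rw [indicator_of_mem (by simpa using hxS), coe_nnnorm_sq]
          apply ENNReal.ofReal_le_ofReal
          obtain ⟨h1, h2, h3, h4⟩ := mem_Ioo_floor_of_notMem_interfaceSet hε0 hxS
          rw [Int.floor_eq_iff.2 hx] at h1 h2
          obtain ⟨d, hd, hdn⟩ := hω' k z _ h1 h2 h3 h4
          rw [(hwd k x d hd).deriv, norm_mul, Complex.norm_real, Real.norm_eq_abs, mul_pow,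
            sq_abs, inv_pow, inv_mul_le_iff₀ (by positivity)]
          refine hdn.trans (le_of_eq ?_)
          ring
    rwa [← mul_assoc] at this
  · rintro α ⟨-, hα⟩
    obtain ⟨K, hK, hrec⟩ := hL.exists_recurrence hh0 hh1
    obtain ⟨K', hK', hdeep⟩ := exists_setLIntegral_deep_le hβ hM hh0 hh1
    obtain ⟨_, _, R₀, hR₀, hr₀⟩ := hρ₀per.exists_pos_bounds hρ₀c hρ₀p
    obtain ⟨_, _, R₁, hR₁, hr₁⟩ := hρ₁per.exists_pos_bounds hρ₁c hρ₁p
    set φ := |v₁ h + p₂ h - lam₀ * v₂ h * ∫ y in h..(1:ℝ), ρ₁ y| with hφ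
    have hφ' : |v₁ h + p₂ h - v₂ h * ∫ y in h..(1:ℝ), lam₀ * ρ₁ y| = φ := by
      rw [hφ, intervalIntegral.integral_const_mul]
      congr 2
      ring
    have hsmall : Tendsto (fun k => K * (ε k ^ 2 + |lam k - lam₀| * (R₀ + R₁))) atTop (𝓝 0) := by
      have h1 : Tendsto (fun k => |lam k - lam₀|) atTop (𝓝 0) := by
        have := (hlam.sub_const lam₀).abs
        rwa [sub_self, abs_zero] at this
      have := ((hε.pow 2).add (h1.mul_const (R₀ + R₁))).const_mul K
      simpa using this
    have hdecay : Tendsto (fun k => ∫⁻ x in {x : ℝ | ε k ^ α ≤ distDefect dm dp x},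
        (‖u k x‖₊ : ENNReal) ^ 2) atTop (𝓝 0) := by
      refine tendsto_setLIntegral_distDefect (C := K') (τ := 1 + φ / 2) (by linarith) hεpos hε
        ?_ hα
      filter_upwards [hsmall.eventually_lt_const (by linarith : 0 < φ / 2 - 1)] with k hk
      refine hdeep _ _ _ _ _ _ _ (ε k) _ (u k) (s k) (hεpos k) (hc k) (hs k) (hInt k) (hnorm k)
        (by linarith) fun z hz' hz => ?_
      have hdens : ∀ {r R : ℝ}, 0 < r → r ≤ R → R ≤ R₀ + R₁ →
          |lam k * r - lam₀ * r| ≤ |lam k - lam₀| * (R₀ + R₁) := by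
        intro r R h1 h2 h3
        rw [← sub_mul, abs_mul, abs_of_pos h1]
        exact mul_le_mul_of_nonneg_left (h2.trans h3) (abs_nonneg _)
      have := hrec β (ε k ^ 2) (|lam k - lam₀| * (R₀ + R₁)) _ _ _ _ _ _ (s k) (sq_nonneg _) (hc k)
        (fun t => hdens (hρ₀p t) (hr₀ t).2 (by linarith))
        (fun t => hdens (hρ₁p t) (hr₁ t).2 (by linarith)) (hs k) z hz' hz
      rw [hφ'] at this
      nlinarith [mul_le_mul_of_nonneg_right hk.le
        (norm_nonneg (nodal (fun t => u k (ε k * t)) (s k) z))]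
    have hw0 : Tendsto (fun k => ENNReal.ofReal (3 * C * ε k ^ 4)) atTop (𝓝 0) := by
      have := ENNReal.tendsto_ofReal ((hε.pow 4).const_mul (3 * C))
      simpa using this
    have hsum : Tendsto (fun k => 2 * ((∫⁻ x in {x : ℝ | ε k ^ α ≤ distDefect dm dp x},
        (‖u k x‖₊ : ENNReal) ^ 2) + ENNReal.ofReal (3 * C * ε k ^ 4))) atTop (𝓝 0) := by
      have := ENNReal.Tendsto.const_mul (a := 2) (hdecay.add hw0) (Or.inr ENNReal.ofNat_ne_top)
      simpa using this
    refine tendsto_of_tendsto_of_tendsto_of_le_of_le tendsto_const_nhds hsum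
      (fun k => zero_le) fun k => ?_
    calc ∫⁻ x in {x : ℝ | ε k ^ α ≤ distDefect dm dp x}, (‖u k x - w k x‖₊ : ENNReal) ^ 2
        ≤ ∫⁻ x in {x : ℝ | ε k ^ α ≤ distDefect dm dp x},
          2 * ((‖u k x‖₊ : ENNReal) ^ 2 + (‖w k x‖₊ : ENNReal) ^ 2) := by
          refine lintegral_mono fun x => ?_
          simp only
          rw [coe_nnnorm_sq, coe_nnnorm_sq, coe_nnnorm_sq,
            ← ENNReal.ofReal_add (by positivity) (by positivity), ← ENNReal.ofReal_ofNat 2,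
            ← ENNReal.ofReal_mul (by positivity)]
          apply ENNReal.ofReal_le_ofReal
          have h1 := pow_le_pow_left₀ (norm_nonneg _) (norm_sub_le (u k x) (w k x)) 2
          nlinarith [sq_nonneg (‖u k x‖ - ‖w k x‖)]
      _ = 2 * ((∫⁻ x in {x : ℝ | ε k ^ α ≤ distDefect dm dp x}, (‖u k x‖₊ : ENNReal) ^ 2) +
          ∫⁻ x in {x : ℝ | ε k ^ α ≤ distDefect dm dp x}, (‖w k x‖₊ : ENNReal) ^ 2) := by
          rw [lintegral_const_mul' _ _ ENNReal.ofNat_ne_top, lintegral_add_right]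
          exact ((hwcont k).measurable.nnnorm.coe_nnreal_ennreal).pow_const 2
      _ ≤ _ := by
          gcongr
          exact (setLIntegral_le_lintegral _ _).trans (hwL k)
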